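/- arXiv:2501.08614 — 3 statements merged into one kernel-verified Lean document; each statement's English description precedes it below -/
import Mathlib

section
/- Among all (n−1)-dimensional simplices contained in an (n−1)-dimensional Euclidean ball of radius ρ, a regular simplex inscribed in the boundary sphere has the greatest volume; in particular every such simplex has volume at most (√n/(n−1)!)·(n/(n−1))^{(n−1)/2}·ρ^{n−1}. -/
open MeasureTheory Metric

/-- The determinant of a matrix whose first column is constant. -/
theorem Matrix.det_of_cons_const {R : Type*} [CommRing R] {m : ℕ} (t : R)
    (x : Fin (m + 1) → Fin m → R) :
    (Matrix.of fun i => (Fin.cons t (x i) : Fin (m + 1) → R)).det =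
      t * (Matrix.of fun i j => x i.succ j - x 0 j).det := by
  rw [Matrix.det_eq_of_forall_row_eq_smul_add_const
    (B := Matrix.of fun i : Fin (m + 1) => (Fin.cases (Fin.cons t (x 0))
      (fun k => Fin.cons 0 (fun j => x k.succ j - x 0 j)) i : Fin (m + 1) → R))
    (Fin.cases 0 fun _ => 1) 0 (by simp)]
  · rw [Matrix.det_succ_column_zero, Fin.sum_univ_succ]
    simp [Matrix.submatrix]
  · intro i j
    refine Fin.cases ?_ (fun k => ?_) i <;> refine Fin.cases ?_ (fun l => ?_) j <;> simp

/-- **Hadamard's inequality** for the rows of a real square matrix. -/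
theorem Matrix.abs_det_le_prod_norm_row {n : ℕ} (A : Matrix (Fin n) (Fin n) ℝ) :
    |A.det| ≤ ∏ i, ‖WithLp.toLp 2 (A i)‖ := by
  have : Fact (Module.finrank ℝ (EuclideanSpace ℝ (Fin n)) = n) := ⟨by simp⟩
  let b := EuclideanSpace.basisFun (Fin n) ℝ
  have h := b.toBasis.orientation.abs_volumeForm_apply_le fun i => WithLp.toLp 2 (A i)
  rw [b.toBasis.orientation.volumeForm_robust b rfl] at h
  have hA : b.toBasis.toMatrix (fun i => WithLp.toLp 2 (A i)) = A.transpose := by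
    ext i j
    simp [b, Module.Basis.toMatrix_apply]
  rwa [Module.Basis.det_apply, hA, Matrix.det_transpose] at h

/-- There is an orthogonal matrix with constant first column. -/
theorem exists_orthogonal_matrix_const_column (m : ℕ) :
    ∃ Q : Matrix (Fin (m + 1)) (Fin (m + 1)) ℝ,
      Q * Q.transpose = 1 ∧ ∀ i, Q i 0 = 1 / √((m : ℝ) + 1) := by
  let u : EuclideanSpace ℝ (Fin (m + 1)) := WithLp.toLp 2 fun _ => 1 / √((m : ℝ) + 1)
  have hm : (0 : ℝ) < (m : ℝ) + 1 := by positivity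
  have hu : ‖u‖ = 1 := by
    simp [EuclideanSpace.norm_eq, u, Real.sq_sqrt hm.le, hm.ne']
  obtain ⟨b, hb⟩ := Orthonormal.exists_orthonormalBasis_extension_of_card_eq (𝕜 := ℝ)
    (E := EuclideanSpace ℝ (Fin (m + 1))) (ι := Fin (m + 1)) (by simp)
    (v := fun _ => u) (s := {0}) (by
      constructor
      · simp [hu]
      · intro i j hij
        exact absurd (Subsingleton.elim i j) hij)
  refine ⟨Matrix.of fun i j => b j i, ?_, fun i => ?_⟩
  · rw [mul_eq_one_comm]
    ext i j
    have h := orthonormal_iff_ite.1 b.orthonormal i j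
    simpa [Matrix.mul_apply, Matrix.one_apply, PiLp.inner_apply, mul_comm] using h
  · simp [hb 0 rfl, u]

open scoped Pointwise in
/-- The volume of a simplex is proportional to the determinant of its edge vectors. -/
theorem volume_convexHull_range_eq {m : ℕ} (x : Fin (m + 1) → EuclideanSpace ℝ (Fin m)) :
    volume (convexHull ℝ (Set.range x)) =
      ENNReal.ofReal |(Matrix.of fun i j => x (Fin.succ i) j - x 0 j).det| *
        volume (convexHull ℝ (Set.range (Fin.cons 0 (EuclideanSpace.basisFun (Fin m) ℝ) :
          Fin (m + 1) → EuclideanSpace ℝ (Fin m)))) := by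
  let b := (EuclideanSpace.basisFun (Fin m) ℝ).toBasis
  let L := b.constr ℝ fun i => x i.succ - x 0
  have hL : LinearMap.det L = (Matrix.of fun i j => x (Fin.succ i) j - x 0 j).det := by
    rw [← LinearMap.det_toMatrix b, ← Matrix.det_transpose]
    congr 1
    ext i j
    simp [LinearMap.toMatrix_apply, L, b.constr_basis]
    simp [b]
  have hx : Set.range x = x 0 +ᵥ (L '' Set.range (Fin.cons 0
      (EuclideanSpace.basisFun (Fin m) ℝ) : Fin (m + 1) → EuclideanSpace ℝ (Fin m))) := by
    rw [← Set.image_vadd, ← Set.range_comp, ← Set.range_comp]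
    congr 1
    ext1 i
    refine Fin.cases (by simp) (fun k => ?_) i
    have : L (EuclideanSpace.basisFun (Fin m) ℝ k) = x k.succ - x 0 := by
      have h := b.constr_basis ℝ (fun i => x i.succ - x 0) k
      rwa [OrthonormalBasis.coe_toBasis] at h
    simp only [Function.comp, Fin.cons_succ, this, vadd_eq_add]
    abel
  rw [← hL, ← Measure.addHaar_image_linearMap, LinearMap.image_convexHull, hx, convexHull_vadd,
    measure_vadd]

/-- The volume of the corner simplex, by counting its reflected copies in the cross-polytope. -/
theorem volume_corner_simplex_le (ι : Type*) [Fintype ι] [Nonempty ι] :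
    volume {z : ι → ℝ | (∀ i, 0 ≤ z i) ∧ ∑ i, z i ≤ 1} ≤
      ENNReal.ofReal (1 / ((Fintype.card ι).factorial : ℝ)) := by
  classical
  let σ : Bool → ℝ → ℝ := fun c a => bif c then a else -a
  let F : (ι → Bool) → Set (ι → ℝ) := fun s => {z | (∀ i, 0 < σ (s i) (z i)) ∧ ∑ i, |z i| ≤ 1}
  have hσ (c : Bool) : MeasurePreserving (σ c) := by
    cases c
    · exact Measure.measurePreserving_neg volume
    · exact MeasurePreserving.id volume
  have hσm (c : Bool) : Measurable (σ c) := (hσ c).measurable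
  have hFm (s : ι → Bool) : MeasurableSet (F s) := by
    refine measurableSet_setOfPred.2 (Measurable.and (Measurable.forall fun i => ?_) ?_)
    · exact measurableSet_setOfPred.1
        (measurableSet_lt measurable_const ((hσm _).comp (measurable_pi_apply i)))
    · exact measurableSet_setOfPred.1 (measurableSet_le (by fun_prop) measurable_const)
  have hF (s : ι → Bool) : volume (F s) = volume (F fun _ => true) := by
    rw [← (volume_preserving_pi fun i => hσ (s i)).measure_preimage
      (hFm fun _ => true).nullMeasurableSet]
    congr 1
    ext z
    have (c : Bool) (a : ℝ) : |σ c a| = |a| := by cases c <;> simp [σ]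
    simp [F, this]
    simp [σ]
  have hdisj : Pairwise (Function.onFun Disjoint F) := by
    intro s t hst
    obtain ⟨i, hi⟩ := Function.ne_iff.1 hst
    refine Set.disjoint_left.2 fun z hz hz' => ?_
    have h1 := hz.1 i
    have h2 := hz'.1 i
    cases hs : s i <;> cases ht : t i <;> simp_all [σ] <;> linarith
  have hsum : (2 : ENNReal) ^ Fintype.card ι * volume (F fun _ => true) ≤
      ENNReal.ofReal (2 ^ Fintype.card ι / ((Fintype.card ι).factorial : ℝ)) := by
    calc (2 : ENNReal) ^ Fintype.card ι * volume (F fun _ => true) = ∑ s, volume (F s) := by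
          simp [hF]
      _ = volume (⋃ s, F s) := by
          rw [measure_iUnion hdisj hFm, tsum_fintype]
      _ ≤ volume {x : ι → ℝ | (∑ i, |x i| ^ (1 : ℝ)) ^ (1 / (1 : ℝ)) ≤ 1} := by
          refine measure_mono (Set.iUnion_subset fun s z hz => ?_)
          simpa using hz.2
      _ = _ := by
          rw [volume_sum_rpow_le ι le_rfl]
          simp [Real.Gamma_nat_eq_factorial, one_add_one_eq_two]
  have hae : volume {z : ι → ℝ | (∀ i, 0 ≤ z i) ∧ ∑ i, z i ≤ 1} ≤ volume (F fun _ => true) := by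
    refine measure_mono_ae ?_
    have : ∀ᵐ z : ι → ℝ, ∀ i, z i ≠ 0 := ae_all_iff.2 fun i => Measure.ae_eval_ne _ i 0
    filter_upwards [this] with z hz h
    refine ⟨fun i => (h.1 i).lt_of_ne (hz i).symm, ?_⟩
    simpa only [abs_of_nonneg (h.1 _)] using h.2
  refine hae.trans ?_
  have h2 : (2 : ENNReal) ^ Fintype.card ι = ENNReal.ofReal (2 ^ Fintype.card ι) := by
    rw [ENNReal.ofReal_pow zero_le_two, ENNReal.ofReal_ofNat]
  rw [div_eq_mul_one_div, ENNReal.ofReal_mul (by positivity), ← h2] at hsum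
  exact (ENNReal.mul_le_mul_iff_right (by simp) (by simp)).1 hsum

/-- The volume of the convex hull of the origin and the standard basis vectors. -/
theorem volume_convexHull_corner_le (m : ℕ) [NeZero m] :
    volume (convexHull ℝ (Set.range (Fin.cons 0 (EuclideanSpace.basisFun (Fin m) ℝ) :
      Fin (m + 1) → EuclideanSpace ℝ (Fin m)))) ≤ ENNReal.ofReal (1 / (m.factorial : ℝ)) := by
  have h := volume_corner_simplex_le (Fin m)
  rw [Fintype.card_fin] at h
  refine le_trans ?_ h
  refine le_trans (measure_mono (convexHull_min ?_ ?_))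
    ((PiLp.volume_preserving_ofLp (Fin m)).measure_preimage_le _)
  · rintro _ ⟨i, rfl⟩
    refine Fin.cases (by simp) (fun k => ?_) i
    simp only [Fin.cons_succ, EuclideanSpace.basisFun_apply, Set.mem_preimage, Set.mem_ofPred_eq]
    refine ⟨fun j => ?_, by simp⟩
    by_cases h : j = k <;> simp [h]
  · intro x hx y hy a b ha hb hab
    refine ⟨fun i => ?_, ?_⟩
    · have h1 := hx.1 i
      have h2 := hy.1 i
      simp only [PiLp.add_apply, PiLp.smul_apply, smul_eq_mul]
      positivity
    · simp only [PiLp.add_apply, PiLp.smul_apply, smul_eq_mul, Finset.sum_add_distrib,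
        ← Finset.mul_sum]
      nlinarith [hx.2, hy.2]

/-- The edge determinant of a simplex contained in a ball. -/
theorem abs_det_edges_le {m : ℕ} {ρ : ℝ} (hρ : 0 < ρ) [NeZero m]
    {x : Fin (m + 1) → EuclideanSpace ℝ (Fin m)} (hx : ∀ i, ‖x i‖ ≤ ρ) :
    |(Matrix.of fun i j => x (Fin.succ i) j - x 0 j).det| ≤
      √((m : ℝ) + 1) * √(((m : ℝ) + 1) / m) ^ m * ρ ^ m := by
  have hm : (0 : ℝ) < m := by exact_mod_cast Nat.pos_of_neZero m
  have hdet := Matrix.det_of_cons_const (ρ / √(m : ℝ)) fun i j => x i j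
  have hH := Matrix.abs_det_le_prod_norm_row
    (Matrix.of fun i => (Fin.cons (ρ / √(m : ℝ)) (fun j => x i j) : Fin (m + 1) → ℝ))
  have hrow (i : Fin (m + 1)) : ‖WithLp.toLp 2 (Matrix.of (fun i =>
      (Fin.cons (ρ / √(m : ℝ)) (fun j => x i j) : Fin (m + 1) → ℝ)) i)‖ ≤
      ρ * √(((m : ℝ) + 1) / m) := by
    refine le_of_sq_le_sq ?_ (by positivity)
    have h := hx i
    have h' : ∑ j, x i j ^ 2 = ‖x i‖ ^ 2 := by simp [EuclideanSpace.norm_sq_eq]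
    rw [EuclideanSpace.norm_sq_eq, Fin.sum_univ_succ, mul_pow, Real.sq_sqrt (by positivity)]
    simp only [Matrix.of_apply, Fin.cons_zero, Fin.cons_succ, Real.norm_eq_abs, sq_abs, div_pow,
      Real.sq_sqrt hm.le, h']
    have : ρ ^ 2 * ((m + 1) / m) = ρ ^ 2 / m + ρ ^ 2 := by field_simp; ring
    rw [this]
    gcongr
  have hprod := hH.trans (Finset.prod_le_prod (fun _ _ => norm_nonneg _) fun i _ => hrow i)
  rw [hdet, abs_mul, abs_of_pos (by positivity), Finset.prod_const, Finset.card_univ,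
    Fintype.card_fin] at hprod
  refine le_of_mul_le_mul_left (hprod.trans_eq ?_) (by positivity : 0 < ρ / √(m : ℝ))
  rw [pow_succ, mul_pow, Real.sqrt_div (by positivity)]
  ring

/-- A regular simplex inscribed in a sphere, together with its edge determinant. -/
theorem exists_regular_simplex_inscribed {m : ℕ} {ρ : ℝ} (hρ : 0 < ρ) [NeZero m] :
    ∃ y : Fin (m + 1) → EuclideanSpace ℝ (Fin m), (∀ i, ‖y i‖ = ρ) ∧
      (∀ i j k l, i ≠ j → k ≠ l → dist (y i) (y j) = dist (y k) (y l)) ∧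
      |(Matrix.of fun i j => y (Fin.succ i) j - y 0 j).det| =
        √((m : ℝ) + 1) * √(((m : ℝ) + 1) / m) ^ m * ρ ^ m := by
  have hm : (0 : ℝ) < m := by exact_mod_cast Nat.pos_of_neZero m
  obtain ⟨Q, hQ, hQ0⟩ := exists_orthogonal_matrix_const_column m
  set s := ρ * √(((m : ℝ) + 1) / m) with hs
  have hspos : 0 < s := by positivity
  have hs2 : s ^ 2 = ρ ^ 2 * ((m + 1) / m) := by
    rw [hs, mul_pow, Real.sq_sqrt (by positivity)]
  have hinner (i k : Fin (m + 1)) :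
      ∑ j : Fin m, Q i j.succ * Q k j.succ = (if i = k then 1 else 0) - 1 / ((m : ℝ) + 1) := by
    have h := congrFun (congrFun hQ i) k
    rw [Matrix.mul_apply, Fin.sum_univ_succ, Matrix.one_apply] at h
    simp only [Matrix.transpose_apply, hQ0] at h
    rw [← h, div_mul_div_comm, Real.mul_self_sqrt (by positivity)]
    ring
  let y : Fin (m + 1) → EuclideanSpace ℝ (Fin m) := fun i => WithLp.toLp 2 fun j => s * Q i j.succ
  have hdist (i j : Fin (m + 1)) (hij : i ≠ j) : dist (y i) (y j) = √(2 * s ^ 2) := by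
    rw [EuclideanSpace.dist_eq]
    congr 1
    have h (l : Fin m) : dist (y i l) (y j l) ^ 2 = s ^ 2 * (Q i l.succ * Q i l.succ) +
        s ^ 2 * (Q j l.succ * Q j l.succ) - 2 * s ^ 2 * (Q i l.succ * Q j l.succ) := by
      rw [Real.dist_eq, sq_abs]
      simp only [y]
      ring
    simp only [h, Finset.sum_sub_distrib, Finset.sum_add_distrib, ← Finset.mul_sum, hinner,
      if_pos, if_neg hij]
    ring
  refine ⟨y, fun i => ?_, fun i j k l hij hkl => by rw [hdist i j hij, hdist k l hkl], ?_⟩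
  · refine (sq_eq_sq₀ (norm_nonneg _) hρ.le).1 ?_
    have h (l : Fin m) : ‖y i l‖ ^ 2 = s ^ 2 * (Q i l.succ * Q i l.succ) := by
      rw [Real.norm_eq_abs, sq_abs]
      simp only [y]
      ring
    simp only [EuclideanSpace.norm_sq_eq, h, ← Finset.mul_sum, hinner, if_pos, hs2]
    field_simp
    ring
  · have hdet := Matrix.det_of_cons_const (s * (1 / √((m : ℝ) + 1))) fun i j => y i j
    have hM : (Matrix.of fun i => (Fin.cons (s * (1 / √((m : ℝ) + 1))) (fun j => y i j) :
        Fin (m + 1) → ℝ)) = s • Q := by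
      ext i j
      refine Fin.cases ?_ (fun l => ?_) j <;> simp [hQ0, y]
    have hQdet : |Q.det| = 1 := by
      have h := congrArg Matrix.det hQ
      rw [Matrix.det_mul, Matrix.det_transpose, Matrix.det_one] at h
      rcases mul_self_eq_one_iff.1 h with h | h <;> simp [h]
    rw [hM, Matrix.det_smul, Fintype.card_fin] at hdet
    have h := congrArg abs hdet
    rw [abs_mul, abs_mul, hQdet, abs_of_pos (by positivity), abs_of_pos (by positivity)] at h
    refine mul_left_cancel₀ (by positivity : s * (1 / √((m : ℝ) + 1)) ≠ 0) (h.symm.trans ?_)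
    rw [pow_succ, hs, mul_pow]
    field_simp

theorem regular_simplex_maximal_volume (n : ℕ) (hn : 2 ≤ n) (ρ : ℝ) (hρ : 0 < ρ) :
    (∃ y : Fin n → EuclideanSpace ℝ (Fin (n - 1)),
      (∀ i, y i ∈ sphere (0 : EuclideanSpace ℝ (Fin (n - 1))) ρ) ∧
      (∀ i j k l : Fin n, i ≠ j → k ≠ l → dist (y i) (y j) = dist (y k) (y l)) ∧
      ∀ x : Fin n → EuclideanSpace ℝ (Fin (n - 1)),
        (∀ i, x i ∈ closedBall (0 : EuclideanSpace ℝ (Fin (n - 1))) ρ) →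
        volume (convexHull ℝ (Set.range x)) ≤ volume (convexHull ℝ (Set.range y))) ∧
    ∀ x : Fin n → EuclideanSpace ℝ (Fin (n - 1)),
      (∀ i, x i ∈ closedBall (0 : EuclideanSpace ℝ (Fin (n - 1))) ρ) →
      (volume (convexHull ℝ (Set.range x))).toReal ≤
        Real.sqrt n / (Nat.factorial (n - 1) : ℝ) *
          ((n : ℝ) / ((n : ℝ) - 1)) ^ (((n : ℝ) - 1) / 2) * ρ ^ (n - 1) := by
  obtain ⟨m, rfl⟩ : ∃ m, n = m + 1 := ⟨n - 1, by omega⟩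
  have : NeZero m := ⟨by omega⟩
  simp only [mem_sphere_zero_iff_norm, mem_closedBall_zero_iff]
  constructor
  · obtain ⟨y, hy, hreg, hdet⟩ := exists_regular_simplex_inscribed (m := m) hρ
    refine ⟨y, hy, hreg, fun x hx => ?_⟩
    have hle := abs_det_edges_le (m := m) hρ hx
    rw [← hdet] at hle
    exact (volume_convexHull_range_eq (m := m) x).trans_le ((mul_le_mul_left
      (ENNReal.ofReal_le_ofReal hle) _).trans_eq (volume_convexHull_range_eq (m := m) y).symm)
  · intro x hx
    have hle := (volume_convexHull_range_eq (m := m) x).trans_le (mul_le_mul'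
      (ENNReal.ofReal_le_ofReal (abs_det_edges_le (m := m) hρ hx)) (volume_convexHull_corner_le m))
    rw [← ENNReal.ofReal_mul (by positivity)] at hle
    refine (ENNReal.toReal_le_of_le_ofReal (by positivity) hle).trans_eq ?_
    have hpow : √(((m : ℝ) + 1) / m) ^ m = (((m : ℝ) + 1) / m) ^ ((m : ℝ) / 2) := by
      rw [Real.sqrt_eq_rpow, ← Real.rpow_natCast, ← Real.rpow_mul (by positivity)]
      ring_nf
    push_cast
    simp only [add_sub_cancel_right, hpow]
    ring
end

section
/- Let n ≥ 2 and let ξ₁,…,ξ_N be i.i.d. uniformly random points on S^{n−1} with N ≥ n+1. There exists a constant b_n depending only on n (one may take b_n = 6^{n/2}·√(e·n)/(n−1)! · vol_{n−1}(S^{n−1})/vol_{n−1}(B₂^{n−1})) such that the expected maximal (n−1)-volume of a facet of the convex hull [ξ₁,…,ξ_N] is at most b_n · (log N)/N. -/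
open MeasureTheory Metric

/-- The uniform probability measure on the unit sphere of `ℝⁿ`. -/
noncomputable def sphereUniform (n : ℕ) : Measure (EuclideanSpace ℝ (Fin n)) :=
  (μH[(n : ℝ) - 1] (sphere (0 : EuclideanSpace ℝ (Fin n)) 1))⁻¹ •
    (μH[(n : ℝ) - 1]).restrict (sphere (0 : EuclideanSpace ℝ (Fin n)) 1)

/-- `F` is a facet of the polytope `P ⊆ ℝⁿ`: an exposed face of dimension `n - 1`. -/
def IsFacet (n : ℕ) (P F : Set (EuclideanSpace ℝ (Fin n))) : Prop :=
  IsExposed ℝ P F ∧ Module.finrank ℝ (vectorSpan ℝ F) = n - 1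

/-- The maximal `(n-1)`-dimensional volume of a facet of `P`. -/
noncomputable def maxFacetVol (n : ℕ) (P : Set (EuclideanSpace ℝ (Fin n))) : ℝ :=
  sSup {v : ℝ | ∃ F, IsFacet n P F ∧ v = (μH[(n : ℝ) - 1] F).toReal}

/-- The corner simplex `{x ≥ 0, ∑ xᵢ ≤ t}` in `ℝᵐ` has volume at most `tᵐ / m!`. -/
lemma volume_cornerSimplex_le (m : ℕ) (t : ℝ) (ht : 0 ≤ t) :
    volume {x : Fin m → ℝ | (∀ i, 0 ≤ x i) ∧ ∑ i, x i ≤ t} ≤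
      ENNReal.ofReal (t ^ m / m.factorial) := by
  induction m generalizing t with
  | zero =>
    refine (measure_mono (Set.subset_univ _)).trans ?_
    rw [volume_pi, Measure.pi_of_empty]
    simp
  | succ m ih =>
    set S : Set (Fin (m + 1) → ℝ) := {x | (∀ i, 0 ≤ x i) ∧ ∑ i, x i ≤ t} with hS
    have hSm : MeasurableSet S := by
      have hc : IsClosed S := by
        have h1 : IsClosed {x : Fin (m + 1) → ℝ | ∀ i, 0 ≤ x i} := by
          simp only [Set.ofPred_forall]
          exact isClosed_iInter fun i => isClosed_le continuous_const (continuous_apply i)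
        have h2 : IsClosed {x : Fin (m + 1) → ℝ | ∑ i, x i ≤ t} :=
          isClosed_le (by fun_prop) continuous_const
        exact h1.inter h2
      exact hc.measurableSet
    have hmp := (volume_preserving_piFinSuccAbove (fun _ : Fin (m + 1) => ℝ) 0).symm
    rw [← hmp.measure_preimage hSm.nullMeasurableSet, Measure.volume_eq_prod,
      Measure.prod_apply (hmp.measurable hSm)]
    have hsec : ∀ s : ℝ, volume (Prod.mk s ⁻¹'
        ((MeasurableEquiv.piFinSuccAbove (fun _ : Fin (m + 1) => ℝ) 0).symm ⁻¹' S)) ≤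
          (Set.Icc 0 t).indicator (fun s => ENNReal.ofReal ((t - s) ^ m / m.factorial)) s := by
      intro s
      by_cases hs : s ∈ Set.Icc 0 t
      · rw [Set.indicator_of_mem hs]
        refine le_trans (measure_mono ?_) (ih (t - s) (by linarith [hs.2]))
        rintro x ⟨hx0, hx1⟩
        refine ⟨fun i => by simpa using hx0 i.succ, ?_⟩
        simp [Fin.sum_univ_succ] at hx1
        linarith
      · rw [Set.indicator_of_notMem hs, nonpos_iff_eq_zero]
        convert measure_empty (μ := (volume : Measure (Fin m → ℝ)))
        rw [Set.eq_empty_iff_forall_notMem]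
        rintro x ⟨hx0, hx1⟩
        have h0 : 0 ≤ s := by simpa using hx0 0
        simp [Fin.sum_univ_succ] at hx1
        have : 0 ≤ ∑ i, x i := Finset.sum_nonneg fun i _ => by simpa using hx0 i.succ
        exact hs ⟨h0, by linarith⟩
    refine (lintegral_mono hsec).trans ?_
    rw [lintegral_indicator measurableSet_Icc, ← ofReal_integral_eq_lintegral_ofReal]
    · apply le_of_eq
      congr 1
      rw [integral_Icc_eq_integral_Ioc, ← intervalIntegral.integral_of_le ht,
        intervalIntegral.integral_div,
        intervalIntegral.integral_comp_sub_left (fun s : ℝ => s ^ m)]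
      simp [Nat.factorial_succ]
      field_simp
    · exact (Continuous.integrableOn_Icc (by fun_prop))
    · filter_upwards [ae_restrict_mem measurableSet_Icc] with s hs
      have : 0 ≤ t - s := by linarith [hs.2]
      positivity

/-- A simplex in `ℝᵐ` whose vertices have norm at most `r` has volume at most `(2r)ᵐ / m!`. -/
lemma volume_convexHull_range_le {m : ℕ} (v : Fin (m + 1) → EuclideanSpace ℝ (Fin m)) (r : ℝ)
    (hv : ∀ i, ‖v i‖ ≤ r) :
    volume (convexHull ℝ (Set.range v)) ≤ ENNReal.ofReal ((2 * r) ^ m / m.factorial) := by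
  set b := EuclideanSpace.basisFun (Fin m) ℝ
  set T : EuclideanSpace ℝ (Fin m) →ₗ[ℝ] EuclideanSpace ℝ (Fin m) :=
    b.toBasis.constr ℝ fun i => v i.succ - v 0 with hT
  set S : Set (Fin m → ℝ) := {x | (∀ i, 0 ≤ x i) ∧ ∑ i, x i ≤ 1} with hS
  set S' : Set (EuclideanSpace ℝ (Fin m)) := WithLp.ofLp ⁻¹' S with hS'
  have hSv : volume S' ≤ ENNReal.ofReal (1 / m.factorial) := by
    have h := volume_cornerSimplex_le m 1 zero_le_one
    rw [one_pow] at h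
    refine le_trans (le_of_eq ?_) h
    exact (PiLp.volume_preserving_ofLp (Fin m)).measure_preimage_equiv
      (f := (MeasurableEquiv.toLp 2 (Fin m → ℝ)).symm) S
  have hsub : convexHull ℝ (Set.range v) ⊆ (fun y => v 0 + y) '' (T '' S') := by
    have himg : (fun y => v 0 + y) '' (T '' S') =
        (AffineMap.const ℝ (EuclideanSpace ℝ (Fin m)) (v 0) + T.toAffineMap) '' S' := by
      rw [Set.image_image]; rfl
    have hconv : Convex ℝ S' := by
      rintro x ⟨hx0, hx1⟩ y ⟨hy0, hy1⟩ a c ha hc hac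
      refine ⟨fun i => ?_, ?_⟩
      · have := hx0 i
        have := hy0 i
        simp
        positivity
      · simp [Finset.sum_add_distrib, ← Finset.mul_sum]
        nlinarith
    rw [himg]
    refine convexHull_min ?_ (hconv.affine_image _)
    rintro _ ⟨i, rfl⟩
    refine Fin.cases ?_ (fun i => ?_) i
    · exact ⟨0, ⟨by simp, by simp⟩, by simp⟩
    · refine ⟨b i, ⟨fun j => ?_, ?_⟩, ?_⟩
      · simp [b, EuclideanSpace.basisFun_apply]
        split_ifs <;> norm_num
      · simp [b]
      · have : T (b i) = v i.succ - v 0 := by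
          rw [hT, ← b.coe_toBasis, Module.Basis.constr_basis]
        simp [this]
  have hdet : |LinearMap.det T| ≤ (2 * r) ^ m := by
    have h1 : LinearMap.det T = b.toBasis.det (fun i => v i.succ - v 0) := by
      rw [← LinearMap.det_toMatrix b.toBasis, Module.Basis.det_apply]
      congr 1
      ext i j
      rw [LinearMap.toMatrix_apply, hT, Module.Basis.constr_basis, Module.Basis.toMatrix_apply]
    have : Fact (Module.finrank ℝ (EuclideanSpace ℝ (Fin m)) = m) := ⟨by simp⟩
    rw [h1, ← Orientation.volumeForm_robust' b.toBasis.orientation b]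
    refine (Orientation.abs_volumeForm_apply_le _ _).trans ?_
    calc ∏ i : Fin m, ‖v i.succ - v 0‖ ≤ ∏ i : Fin m, (2 * r) :=
          Finset.prod_le_prod (fun _ _ => norm_nonneg _) fun i _ =>
            (norm_sub_le _ _).trans (by linarith [hv i.succ, hv 0])
      _ = (2 * r) ^ m := by simp
  calc volume (convexHull ℝ (Set.range v))
      ≤ volume ((fun y => v 0 + y) '' (T '' S')) := measure_mono hsub
    _ = ENNReal.ofReal |LinearMap.det T| * volume S' := by
        rw [Set.image_add_left, measure_preimage_add, Measure.addHaar_image_linearMap]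
    _ ≤ ENNReal.ofReal ((2 * r) ^ m) * ENNReal.ofReal (1 / m.factorial) := by gcongr
    _ = _ := by
        rw [← ENNReal.ofReal_mul ((abs_nonneg _).trans hdet), mul_one_div]

/-- Isometric coordinates on the hyperplane orthogonal to a unit vector, together with the
orthogonal projection onto it. -/
lemma exists_hyperplane_coordinates {m : ℕ} (u : EuclideanSpace ℝ (Fin (m + 1)))
    (hu : ‖u‖ = 1) :
    ∃ (L : EuclideanSpace ℝ (Fin m) →ₗᵢ[ℝ] EuclideanSpace ℝ (Fin (m + 1)))
      (q : EuclideanSpace ℝ (Fin (m + 1)) → EuclideanSpace ℝ (Fin m)),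
      LipschitzWith 1 q ∧ (∀ z, inner ℝ u (L z) = 0) ∧
      (∀ x, x = inner ℝ u x • u + L (q x)) ∧ ∀ (t : ℝ) z, q (t • u + L z) = z := by
  have : Fact (Module.finrank ℝ (EuclideanSpace ℝ (Fin (m + 1))) = m + 1) := ⟨by simp⟩
  have hu0 : u ≠ 0 := by
    rintro rfl
    simp at hu
  set b := OrthonormalBasis.fromOrthogonalSpanSingleton (𝕜 := ℝ) m hu0
  set K := (Submodule.span ℝ {u})ᗮ
  have hx : ∀ x, x = inner ℝ u x • u + (K.orthogonalProjectionOnto x : EuclideanSpace ℝ _) := by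
    intro x
    have h := Submodule.starProjection_add_starProjection_orthogonal (K := Submodule.span ℝ {u}) x
    rw [Submodule.starProjection_unit_singleton ℝ hu] at h
    exact h.symm
  have hL : ∀ z : K, inner ℝ u (z : EuclideanSpace ℝ (Fin (m + 1))) = 0 := fun z =>
    (Submodule.mem_orthogonal_singleton_iff_inner_right).1 z.2
  refine ⟨K.subtypeₗᵢ.comp b.repr.symm.toLinearIsometry,
    fun x => b.repr (K.orthogonalProjectionOnto x), ?_, ?_, ?_, ?_⟩
  · simpa [Function.comp_def] using
      b.repr.isometry.lipschitz.comp K.lipschitzWith_orthogonalProjectionOnto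
  · intro z
    simpa using hL (b.repr.symm z)
  · intro x
    simpa using hx x
  · intro t z
    have hz := hx (t • u + (b.repr.symm z : EuclideanSpace ℝ (Fin (m + 1))))
    rw [inner_add_right, hL, inner_smul_right, real_inner_self_eq_norm_sq, hu] at hz
    simp only [one_pow, mul_one, add_zero, add_right_inj] at hz
    have hz' := Subtype.ext hz
    change b.repr (K.orthogonalProjectionOnto
      (t • u + (b.repr.symm z : EuclideanSpace ℝ (Fin (m + 1))))) = z
    rw [← hz']
    simp

lemma norm_smul_add_sq {m : ℕ} {u : EuclideanSpace ℝ (Fin (m + 1))} (hu : ‖u‖ = 1)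
    {L : EuclideanSpace ℝ (Fin m) →ₗᵢ[ℝ] EuclideanSpace ℝ (Fin (m + 1))}
    (hL : ∀ z, inner ℝ u (L z) = 0) (t : ℝ) (z : EuclideanSpace ℝ (Fin m)) :
    ‖t • u + L z‖ ^ 2 = t ^ 2 + ‖z‖ ^ 2 := by
  rw [norm_add_sq_real, inner_smul_left, hL, norm_smul, hu, L.norm_map]
  simp

lemma isometry_add_map {m k : ℕ} (w : EuclideanSpace ℝ (Fin k))
    (L : EuclideanSpace ℝ (Fin m) →ₗᵢ[ℝ] EuclideanSpace ℝ (Fin k)) :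
    Isometry fun z => w + L z :=
  (IsometryEquiv.addLeft w).isometry.comp L.isometry

/-- The Hausdorff measure on `ℝᵐ` is an additive Haar measure. -/
lemma isAddHaarMeasure_hausdorffMeasure_euclidean (m : ℕ) :
    (μH[(m : ℝ)] : Measure (EuclideanSpace ℝ (Fin m))).IsAddHaarMeasure := by
  simpa using isAddHaarMeasure_hausdorffMeasure (E := EuclideanSpace ℝ (Fin m))

/-- A hyperplane section of the unit sphere of `ℝᵐ⁺¹` is negligible for the `m`-dimensional
Hausdorff measure. -/
lemma hausdorffMeasure_sphere_inter_hyperplane {m : ℕ} (hm : 1 ≤ m)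
    {a : EuclideanSpace ℝ (Fin (m + 1))} (ha : a ≠ 0) (c : ℝ) :
    μH[(m : ℝ)] (sphere (0 : EuclideanSpace ℝ (Fin (m + 1))) 1 ∩ {x | inner ℝ a x = c}) = 0 := by
  have := isAddHaarMeasure_hausdorffMeasure_euclidean m
  have : Nonempty (Fin m) := ⟨⟨0, hm⟩⟩
  set u := ‖a‖⁻¹ • a
  have hu : ‖u‖ = 1 := norm_smul_inv_norm ha
  obtain ⟨L, q, -, hL, hx, -⟩ := exists_hyperplane_coordinates u hu
  have hsub : sphere (0 : EuclideanSpace ℝ (Fin (m + 1))) 1 ∩ {x | inner ℝ a x = c} ⊆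
      (fun z => (‖a‖⁻¹ * c) • u + L z) '' sphere 0 (√(1 - (‖a‖⁻¹ * c) ^ 2)) := by
    rintro x ⟨hxs, hxc⟩
    have hux : inner ℝ u x = ‖a‖⁻¹ * c := by
      rw [← (show inner ℝ a x = c from hxc), inner_smul_left]
      simp
    have hdec := hx x
    rw [hux] at hdec
    refine ⟨q x, ?_, hdec.symm⟩
    have h1 := norm_smul_add_sq hu hL (‖a‖⁻¹ * c) (q x)
    rw [← hdec, mem_sphere_zero_iff_norm.1 hxs] at h1
    rw [mem_sphere_zero_iff_norm, ← Real.sqrt_sq (norm_nonneg (q x))]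
    congr 1
    linarith
  refine measure_mono_null hsub ?_
  rw [Isometry.hausdorffMeasure_image (isometry_add_map _ L) (Or.inl (by positivity))]
  exact Measure.addHaar_sphere _ _ _

/-- A simplex inscribed in the unit sphere of `ℝᵐ⁺¹` and contained in a hyperplane has small volume
compared to either of the caps which the hyperplane cuts off. -/
lemma hausdorffMeasure_convexHull_mul_le {m : ℕ} (hm : 1 ≤ m)
    {a : EuclideanSpace ℝ (Fin (m + 1))} (ha : a ≠ 0)
    (p : Fin (m + 1) → EuclideanSpace ℝ (Fin (m + 1))) (hp : ∀ i, p i ∈ sphere 0 1)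
    (hap : ∀ i, inner ℝ a (p i - p 0) = 0) :
    μH[(m : ℝ)] (convexHull ℝ (Set.range p)) *
        volume (ball (0 : EuclideanSpace ℝ (Fin m)) 1) ≤
      ENNReal.ofReal (2 ^ m / m.factorial) *
        μH[(m : ℝ)] (sphere 0 1 ∩ {x | 0 < inner ℝ a (x - p 0)}) := by
  have := isAddHaarMeasure_hausdorffMeasure_euclidean m
  have : Nonempty (Fin m) := ⟨⟨0, hm⟩⟩
  set u := ‖a‖⁻¹ • a with hudef
  have hu : ‖u‖ = 1 := norm_smul_inv_norm ha
  have hau : ∀ x, inner ℝ a x = ‖a‖ * inner ℝ u x := by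
    intro x
    rw [hudef, inner_smul_left]
    have := norm_ne_zero_iff.2 ha
    simp
    field_simp
  have hapos : 0 < ‖a‖ := norm_pos_iff.2 ha
  obtain ⟨L, q, hq, hL, hx, hqL⟩ := exists_hyperplane_coordinates u hu
  set c := inner ℝ u (p 0) with hc
  have hpc : ∀ i, inner ℝ u (p i) = c := by
    intro i
    have h := hap i
    rw [hau, mul_eq_zero, inner_sub_right, sub_eq_zero] at h
    exact h.resolve_left hapos.ne'
  have hpd : ∀ i, p i = c • u + L (q (p i)) := by
    intro i
    have h := hx (p i)
    rwa [hpc] at h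
  have hnorm : ∀ i, c ^ 2 + ‖q (p i)‖ ^ 2 = 1 := by
    intro i
    have h1 := norm_smul_add_sq hu hL c (q (p i))
    rw [← hpd, mem_sphere_zero_iff_norm.1 (hp i)] at h1
    linarith
  set r := ‖q (p 0)‖ with hr
  have hr0 : 0 ≤ r := norm_nonneg _
  have hqr : ∀ i, ‖q (p i)‖ ≤ r := fun i =>
    abs_le_of_sq_le_sq' (by linarith [hnorm i, hnorm 0]) hr0 |>.2
  have hF : convexHull ℝ (Set.range p) =
      (fun z => c • u + L z) '' convexHull ℝ (Set.range fun i => q (p i)) := by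
    set f : EuclideanSpace ℝ (Fin m) →ᵃ[ℝ] EuclideanSpace ℝ (Fin (m + 1)) :=
      AffineMap.const ℝ (EuclideanSpace ℝ (Fin m)) (c • u) + L.toLinearMap.toAffineMap
    change _ = f '' _
    rw [f.image_convexHull, ← Set.range_comp]
    congr 2
    exact funext hpd
  have hcap : ball 0 r ⊆ q '' (sphere 0 1 ∩ {x | 0 < inner ℝ a (x - p 0)}) := by
    intro z hz
    rw [mem_ball_zero_iff] at hz
    have hz2 : c ^ 2 < 1 - ‖z‖ ^ 2 := by nlinarith [hnorm 0, norm_nonneg z]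
    have hs0 : 0 ≤ 1 - ‖z‖ ^ 2 := (sq_nonneg c).trans hz2.le
    refine ⟨√(1 - ‖z‖ ^ 2) • u + L z, ⟨?_, ?_⟩, hqL _ _⟩
    · rw [mem_sphere_zero_iff_norm, ← sq_eq_sq₀ (norm_nonneg _) zero_le_one,
        norm_smul_add_sq hu hL, Real.sq_sqrt hs0]
      ring
    · change 0 < inner ℝ a _
      rw [hau, inner_sub_right, inner_add_right, hL, inner_smul_right,
        real_inner_self_eq_norm_sq, hu]
      have := Real.lt_sqrt_of_sq_lt hz2
      apply mul_pos hapos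
      rw [← hc]
      linarith
  have hball : μH[(m : ℝ)] (ball (0 : EuclideanSpace ℝ (Fin m)) r) ≤
      μH[(m : ℝ)] (sphere 0 1 ∩ {x | 0 < inner ℝ a (x - p 0)}) := by
    refine (measure_mono hcap).trans ?_
    simpa using hq.hausdorffMeasure_image_le (d := (m : ℝ)) (by positivity)
      (sphere 0 1 ∩ {x | 0 < inner ℝ a (x - p 0)})
  obtain ⟨κ, hκ⟩ : ∃ κ : NNReal, (μH[(m : ℝ)] : Measure (EuclideanSpace ℝ (Fin m))) =
      κ • volume := ⟨_, Measure.isAddLeftInvariant_eq_smul _ _⟩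
  rw [hF, Isometry.hausdorffMeasure_image (isometry_add_map _ L) (Or.inl (by positivity))]
  refine le_trans ?_ (mul_le_mul_right hball _)
  rw [hκ, Measure.smul_apply, Measure.smul_apply, Measure.addHaar_ball _ _ hr0,
    finrank_euclideanSpace_fin]
  simp only [ENNReal.smul_def, smul_eq_mul]
  calc (κ : ENNReal) * volume (convexHull ℝ (Set.range fun i => q (p i))) *
        volume (ball (0 : EuclideanSpace ℝ (Fin m)) 1)
      ≤ κ * ENNReal.ofReal ((2 * r) ^ m / m.factorial) *
        volume (ball (0 : EuclideanSpace ℝ (Fin m)) 1) := by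
        gcongr
        exact volume_convexHull_range_le _ _ hqr
    _ = _ := by
        have : (2 * r) ^ m / m.factorial = 2 ^ m / m.factorial * r ^ m := by ring
        rw [this, ENNReal.ofReal_mul (by positivity)]
        ring

/-- Given a measurable family `A` of sets depending on the `s`-coordinates of an i.i.d. sample, the
probability that the random set has measure at least `t` and is missed by all sample points with
index in `J` is at most `(1 - t) ^ |J|`. -/
lemma pi_random_set_missed_le {X ι κ : Type*} [MeasurableSpace X] [Fintype ι]
    [Fintype κ] (σ : Measure X) [IsProbabilityMeasure σ] (s : κ → ι) (J : Finset ι)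
    (hJ : ∀ j ∈ J, j ∉ Set.range s) {A : Set ((κ → X) × X)} (hA : MeasurableSet A)
    (t : ENNReal) :
    Measure.pi (fun _ : ι => σ) {ω | t ≤ σ {x | (ω ∘ s, x) ∈ A} ∧
      ∀ j ∈ J, (ω ∘ s, ω j) ∉ A} ≤ (1 - t) ^ J.card := by
  classical
  set B : Set (ι → X) := {ω | t ≤ σ {x | (ω ∘ s, x) ∈ A} ∧ ∀ j ∈ J, (ω ∘ s, ω j) ∉ A} with hB
  have hcomp : Measurable fun ω : ι → X => ω ∘ s :=
    measurable_pi_lambda _ fun i => measurable_pi_apply _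
  have hBm : MeasurableSet B := by
    have h1 : MeasurableSet {ω : ι → X | t ≤ σ {x | (ω ∘ s, x) ∈ A}} :=
      measurableSet_le measurable_const ((measurable_measure_prodMk_left hA).comp hcomp)
    have h2 : MeasurableSet {ω : ι → X | ∀ j ∈ J, (ω ∘ s, ω j) ∉ A} := by
      simp only [Set.ofPred_forall]
      refine MeasurableSet.iInter fun j => MeasurableSet.iInter fun _ => ?_
      exact (hcomp.prodMk (measurable_pi_apply j)) hA.compl
    exact h1.inter h2
  have hmp := (measurePreserving_piEquivPiSubtypeProd (fun _ : ι => σ) (· ∈ Set.range s)).symm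
  rw [← hmp.measure_preimage hBm.nullMeasurableSet, Measure.prod_apply (hmp.measurable hBm)]
  refine (lintegral_mono (g := fun _ => (1 - t) ^ J.card) fun a => ?_).trans (by simp)
  set p : κ → X := fun i => a ⟨s i, i, rfl⟩ with hp
  have hval : ∀ b, (MeasurableEquiv.piEquivPiSubtypeProd (fun _ : ι => X)
      (· ∈ Set.range s)).symm (a, b) ∘ s = p := by
    intro b
    funext i
    simp [MeasurableEquiv.piEquivPiSubtypeProd, Equiv.piEquivPiSubtypeProd, hp]
  by_cases ht : t ≤ σ {x | (p, x) ∈ A}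
  · set J' : Finset {i // i ∉ Set.range s} := J.subtype _ with hJ'
    have hcard : J'.card = J.card := by
      rw [hJ', Finset.card_subtype, Finset.filter_true_of_mem hJ]
    have hsub : Prod.mk a ⁻¹' ((MeasurableEquiv.piEquivPiSubtypeProd (fun _ : ι => X)
        (· ∈ Set.range s)).symm ⁻¹' B) ⊆ (J' : Set _).pi fun _ => {x | (p, x) ∈ A}ᶜ := by
      rintro b ⟨-, hb⟩ j hj
      have hj' : (j : ι) ∈ J := by simpa [hJ'] using hj
      have h := hb j hj'
      rw [hval] at h
      have hbj : (MeasurableEquiv.piEquivPiSubtypeProd (fun _ : ι => X)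
          (· ∈ Set.range s)).symm (a, b) j = b j := by
        have := j.2
        simp only [MeasurableEquiv.piEquivPiSubtypeProd, Equiv.piEquivPiSubtypeProd]
        exact dif_neg this
      rwa [hbj] at h
    refine (measure_mono hsub).trans ?_
    have hpA : MeasurableSet {x | (p, x) ∈ A} := measurable_prodMk_left hA
    rw [Measure.pi_pi_finset, Finset.prod_const, hcard, prob_compl_eq_one_sub hpA]
    exact pow_le_pow_left' (tsub_le_tsub_left ht 1) _
  · refine le_of_eq_of_le (measure_mono_null (t := ∅) ?_ measure_empty) zero_le
    rintro b ⟨hb, -⟩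
    rw [hval] at hb
    exact ht hb

/-- A measurable choice of a normal vector to the affine span of `m + 1` points of `ℝᵐ⁺¹`. -/
lemma exists_measurable_normal (m : ℕ) :
    ∃ ν : (Fin (m + 1) → EuclideanSpace ℝ (Fin (m + 1))) → EuclideanSpace ℝ (Fin (m + 1)),
      Measurable ν ∧ (∀ p i, inner ℝ (ν p) (p i - p 0) = 0) ∧
      ∀ p, AffineIndependent ℝ p → ν p ≠ 0 := by
  set b := EuclideanSpace.basisFun (Fin (m + 1)) ℝ with hb
  set d : (Fin (m + 1) → EuclideanSpace ℝ (Fin (m + 1))) → EuclideanSpace ℝ (Fin (m + 1)) → ℝ :=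
    fun p y => b.toBasis.det (Fin.cons y fun i : Fin m => p i.succ - p 0) with hd
  have hlin : ∀ p, ∃ f : EuclideanSpace ℝ (Fin (m + 1)) →ₗ[ℝ] ℝ, ∀ y, f y = d p y := by
    intro p
    refine ⟨b.toBasis.det.toMultilinearMap.toLinearMap
      (Fin.cons 0 fun i : Fin m => p i.succ - p 0) 0, fun y => ?_⟩
    simp [hd, Fin.update_cons_zero]
  have hinner : ∀ p y, inner ℝ (∑ i, d p (b i) • b i) y = d p y := by
    intro p y
    obtain ⟨f, hf⟩ := hlin p
    rw [sum_inner, ← hf]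
    conv_rhs => rw [← b.sum_repr y, map_sum]
    refine Finset.sum_congr rfl fun i _ => ?_
    rw [map_smul, hf, b.repr_apply_apply, inner_smul_left]
    simp [mul_comm]
  refine ⟨fun p => ∑ i, d p (b i) • b i, ?_, ?_, ?_⟩
  · have hdc : ∀ y, Continuous fun p => d p y := by
      intro y
      simp only [hd, Module.Basis.det_apply]
      refine Continuous.matrix_det (continuous_matrix fun i j => ?_)
      simp only [Module.Basis.toMatrix_apply, OrthonormalBasis.coe_toBasis_repr_apply]
      refine Fin.cases ?_ (fun j => ?_) j
      · simp only [Fin.cons_zero]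
        exact continuous_const
      · simp only [Fin.cons_succ, b, EuclideanSpace.basisFun_repr]
        fun_prop
    exact (continuous_finsetSum _ fun i _ => (hdc (b i)).smul continuous_const).measurable
  · intro p i
    rw [hinner]
    refine Fin.cases ?_ (fun i => ?_) i
    · obtain ⟨f, hf⟩ := hlin p
      rw [← hf, sub_self, map_zero]
    · exact b.toBasis.det.map_eq_zero_of_eq _ (i := 0) (j := i.succ) (by simp)
        (Fin.succ_ne_zero i).symm
  · intro p hp h0
    beta_reduce at h0
    have hli : LinearIndependent ℝ fun i : Fin m => p i.succ - p 0 := by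
      rw [affineIndependent_iff_linearIndependent_vsub ℝ p 0] at hp
      exact hp.comp (fun i : Fin m => (⟨i.succ, Fin.succ_ne_zero i⟩ : {x : Fin (m + 1) // x ≠ 0}))
        fun i j hij => Fin.succ_injective _ (congrArg Subtype.val hij)
    obtain ⟨y, hy⟩ : ∃ y, y ∉ Submodule.span ℝ (Set.range fun i : Fin m => p i.succ - p 0) := by
      by_contra! hall
      have htop := (Submodule.eq_top_iff'.2 hall)
      have := finrank_span_eq_card hli
      rw [htop] at this
      simp at this
    have hli' : LinearIndependent ℝ (Fin.cons y fun i : Fin m => p i.succ - p 0 :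
        Fin (m + 1) → EuclideanSpace ℝ (Fin (m + 1))) := hli.finCons hy
    have hdy : d p y = 0 := by rw [← hinner, h0, inner_zero_left]
    have hunit := (b.toBasis.is_basis_iff_det).1
      ⟨hli', hli'.span_eq_top_of_card_eq_finrank (by simp)⟩
    exact hunit.ne_zero hdy

/-- An exposed face of the convex hull of a finite set is the convex hull of the points of that
set which it contains. -/
lemma IsExposed.eq_convexHull_inter {E : Type*} [NormedAddCommGroup E] [NormedSpace ℝ E]
    {V F : Set E} (hV : V.Finite) (hF : IsExposed ℝ (convexHull ℝ V) F) :
    F = convexHull ℝ (V ∩ F) := by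
  have hcomp : IsCompact F := hF.isCompact (hV.isCompact_convexHull (𝕜 := ℝ))
  have hconv : Convex ℝ F := hF.convex (convex_convexHull ℝ V)
  refine Set.Subset.antisymm ?_ (convexHull_min Set.inter_subset_right hconv)
  have hext : F.extremePoints ℝ ⊆ V ∩ F := fun x hx =>
    ⟨extremePoints_convexHull_subset (hF.isExtreme.extremePoints_subset_extremePoints hx), hx.1⟩
  have hclosed : IsClosed (convexHull ℝ (V ∩ F)) :=
    ((hV.subset Set.inter_subset_left).isCompact_convexHull (𝕜 := ℝ)).isClosed
  calc F = closure (convexHull ℝ (F.extremePoints ℝ)) :=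
        (closure_convexHull_extremePoints hcomp hconv).symm
    _ ⊆ convexHull ℝ (V ∩ F) := closure_minimal (convexHull_mono hext) hclosed

/-- A facet of the convex hull of a finite family contains `m + 1` affinely independent members of
the family, and is cut out by a supporting hyperplane. -/
lemma IsFacet.exists_supporting {m N : ℕ} (hm : 1 ≤ m)
    {ω : Fin N → EuclideanSpace ℝ (Fin (m + 1))} {F : Set (EuclideanSpace ℝ (Fin (m + 1)))}
    (hF : IsFacet (m + 1) (convexHull ℝ (Set.range ω)) F) :
    ∃ (s : Fin (m + 1) ↪ Fin N) (a : EuclideanSpace ℝ (Fin (m + 1))),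
      AffineIndependent ℝ (ω ∘ s) ∧ (∀ i, inner ℝ a (ω (s i) - ω (s 0)) = 0) ∧
      (∀ j, inner ℝ a (ω j - ω (s 0)) ≤ 0) ∧
      (∀ j, inner ℝ a (ω j - ω (s 0)) = 0 → ω j ∈ affineSpan ℝ (Set.range (ω ∘ s))) ∧
      F = convexHull ℝ (Set.range ω ∩ F) ∧ F ⊆ affineSpan ℝ (Set.range (ω ∘ s)) := by
  obtain ⟨hexp, hrank⟩ := hF
  have hFne : F.Nonempty := by
    by_contra hne
    rw [Set.not_nonempty_iff_eq_empty] at hne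
    subst hne
    rw [vectorSpan_empty, finrank_bot] at hrank
    omega
  have hFW := hexp.eq_convexHull_inter (Set.finite_range ω)
  set W := Set.range ω ∩ F with hW
  obtain ⟨l, hl⟩ := hexp hFne
  obtain ⟨t, htW, htspan, htind⟩ := exists_affineIndependent ℝ (EuclideanSpace ℝ (Fin (m + 1))) W
  have hspanF : affineSpan ℝ t = affineSpan ℝ F := by
    rw [htspan, hFW, affineSpan_convexHull]
  have htfin : Finite t := ((Set.finite_range ω).subset (htW.trans Set.inter_subset_left))
  have := Fintype.ofFinite t
  have htne : Nonempty t := by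
    rw [Set.nonempty_coe_sort, ← affineSpan_nonempty ℝ, hspanF, affineSpan_nonempty]
    exact hFne
  have hcard : Fintype.card t = m + 1 := by
    rw [← htind.finrank_vectorSpan_add_one, Subtype.range_coe, ← direction_affineSpan, hspanF,
      direction_affineSpan, hrank]
    rfl
  set e : Fin (m + 1) ≃ t := (Fintype.equivFinOfCardEq hcard).symm
  have hex : ∀ i, ∃ j, ω j = e i := fun i => (htW (e i).2).1
  choose s hs using hex
  have hωs : ω ∘ s = (fun x : t => (x : EuclideanSpace ℝ (Fin (m + 1)))) ∘ e := funext hs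
  have hrange : Set.range (ω ∘ s) = t := by
    rw [hωs, e.surjective.range_comp, Subtype.range_coe]
  have hsinj : Function.Injective s := by
    refine Function.Injective.of_comp (f := ω) ?_
    rw [hωs]
    exact Subtype.val_injective.comp e.injective
  have hsF : ∀ i, ω (s i) ∈ F := fun i => by
    rw [hs]
    exact (htW (e i).2).2
  set a := (InnerProductSpace.toDual ℝ (EuclideanSpace ℝ (Fin (m + 1)))).symm l
  have ha : ∀ x, inner ℝ a x = l x := fun x => InnerProductSpace.toDual_symm_apply
  have hωP : ∀ j, ω j ∈ convexHull ℝ (Set.range ω) := fun j => subset_convexHull _ _ ⟨j, rfl⟩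
  have hmax : ∀ x ∈ F, ∀ y ∈ convexHull ℝ (Set.range ω), l y ≤ l x := by
    intro x hx y hy
    rw [hl] at hx
    exact hx.2 y hy
  refine ⟨⟨s, hsinj⟩, a, ?_, ?_, ?_, ?_, hFW, ?_⟩
  · change AffineIndependent ℝ (ω ∘ s)
    rw [hωs]
    exact htind.comp_embedding e.toEmbedding
  · intro i
    change inner ℝ a (ω (s i) - ω (s 0)) = 0
    rw [ha, map_sub, sub_eq_zero]
    exact le_antisymm (hmax _ (hsF 0) _ (hωP _)) (hmax _ (hsF i) _ (hωP _))
  · intro j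
    change inner ℝ a (ω j - ω (s 0)) ≤ 0
    rw [ha, map_sub, sub_nonpos]
    exact hmax _ (hsF 0) _ (hωP _)
  · intro j hj
    change ω j ∈ affineSpan ℝ (Set.range (ω ∘ s))
    change inner ℝ a (ω j - ω (s 0)) = 0 at hj
    rw [ha, map_sub, sub_eq_zero] at hj
    rw [hrange, hspanF]
    refine subset_affineSpan ℝ F ?_
    rw [hl]
    exact ⟨hωP j, fun y hy => hj ▸ hmax _ (hsF 0) y hy⟩
  · change F ⊆ affineSpan ℝ (Set.range (ω ∘ s))
    rw [hrange, hspanF]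
    exact subset_affineSpan ℝ F

/-- Points of the affine span of `p` satisfy the equation of any hyperplane containing `p`. -/
lemma inner_sub_eq_zero_of_mem_affineSpan {E ι : Type*} [NormedAddCommGroup E]
    [InnerProductSpace ℝ E] {p : ι → E} {i₀ : ι} {a x : E}
    (ha : ∀ i, inner ℝ a (p i - p i₀) = 0) (hx : x ∈ affineSpan ℝ (Set.range p)) :
    inner ℝ a (x - p i₀) = 0 := by
  refine affineSpan_induction (p := fun y => inner ℝ a (y - p i₀) = 0) hx ?_ ?_
  · rintro _ ⟨i, rfl⟩
    exact ha i
  · intro c u v w hu hv hw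
    have : (c • (u -ᵥ v) +ᵥ w) - p i₀ = c • ((u - p i₀) - (v - p i₀)) + (w - p i₀) := by
      simp [add_sub_assoc]
    rw [this, inner_add_right, inner_smul_right, inner_sub_right, hu, hv, hw]
    simp

/-- Two normal vectors of the same hyperplane are proportional. -/
lemma exists_eq_smul_of_normal {m : ℕ} {p : Fin (m + 1) → EuclideanSpace ℝ (Fin (m + 1))}
    (hp : AffineIndependent ℝ p) {a ν : EuclideanSpace ℝ (Fin (m + 1))} (hν0 : ν ≠ 0)
    (ha : ∀ i, inner ℝ a (p i - p 0) = 0) (hν : ∀ i, inner ℝ ν (p i - p 0) = 0) :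
    ∃ k : ℝ, k • ν = a := by
  set K := vectorSpan ℝ (Set.range p) with hK
  have hfin : Module.finrank ℝ K = m := by
    have := hp.finrank_vectorSpan_add_one
    simpa using this
  have hperp : Module.finrank ℝ Kᗮ = 1 := by
    have := K.finrank_add_finrank_orthogonal
    rw [hfin, finrank_euclideanSpace_fin] at this
    omega
  have hmem : ∀ b : EuclideanSpace ℝ (Fin (m + 1)),
      (∀ i, inner ℝ b (p i - p 0) = 0) → b ∈ Kᗮ := by
    intro b hb
    rw [hK, vectorSpan_range_eq_span_range_vsub_right ℝ p 0, Submodule.mem_orthogonal']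
    intro y hy
    induction hy using Submodule.span_induction with
    | mem y hy =>
      obtain ⟨i, rfl⟩ := hy
      exact hb i
    | zero => exact inner_zero_right _
    | add x y _ _ hx hy => rw [inner_add_right, hx, hy, add_zero]
    | smul c x _ hx => rw [inner_smul_right, hx, mul_zero]
  obtain ⟨k, hk⟩ := (finrank_eq_one_iff_of_nonzero' (⟨ν, hmem ν hν⟩ : Kᗮ)
    (fun h => hν0 (congrArg Subtype.val h))).1 hperp ⟨a, hmem a ha⟩
  exact ⟨k, congrArg Subtype.val hk⟩

/-- In general position, a facet of an inscribed polytope is dominated by an empty cap. -/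
lemma IsFacet.exists_empty_cap {m N : ℕ} (hm : 1 ≤ m) (hN : m + 2 ≤ N)
    {ν : (Fin (m + 1) → EuclideanSpace ℝ (Fin (m + 1))) → EuclideanSpace ℝ (Fin (m + 1))}
    (hν : ∀ p i, inner ℝ (ν p) (p i - p 0) = 0)
    (hν0 : ∀ p, AffineIndependent ℝ p → ν p ≠ 0)
    {ω : Fin N → EuclideanSpace ℝ (Fin (m + 1))} (hω : ∀ i, ω i ∈ sphere 0 1)
    (hgp : ∀ (s : Fin (m + 1) ↪ Fin N) (j : Fin N), j ∉ Set.range s → ν (ω ∘ s) ≠ 0 →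
      inner ℝ (ν (ω ∘ s)) (ω j - ω (s 0)) ≠ 0)
    {F : Set (EuclideanSpace ℝ (Fin (m + 1)))}
    (hF : IsFacet (m + 1) (convexHull ℝ (Set.range ω)) F) :
    ∃ (s : Fin (m + 1) ↪ Fin N) (b : Bool),
      (∀ j ∉ Set.range s,
        ¬ 0 < inner ℝ ((bif b then (1 : ℝ) else -1) • ν (ω ∘ s)) (ω j - ω (s 0))) ∧
      μH[(m : ℝ)] F * volume (ball (0 : EuclideanSpace ℝ (Fin m)) 1) ≤
        ENNReal.ofReal (2 ^ m / m.factorial) * μH[(m : ℝ)] (sphere 0 1 ∩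
          {x | 0 < inner ℝ ((bif b then (1 : ℝ) else -1) • ν (ω ∘ s)) (x - ω (s 0))}) := by
  obtain ⟨s, a, hind, has, hale, haeq, hFW, hFs⟩ := hF.exists_supporting hm
  have hνs := hν0 _ hind
  have hspan : ∀ j, ω j ∈ affineSpan ℝ (Set.range (ω ∘ s)) → j ∈ Set.range s := by
    intro j hj
    by_contra hjs
    exact hgp s j hjs hνs (inner_sub_eq_zero_of_mem_affineSpan (p := ω ∘ s) (i₀ := 0)
      (hν (ω ∘ s)) hj)
  have hsub : F ⊆ convexHull ℝ (Set.range (ω ∘ s)) := by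
    rw [hFW]
    refine convexHull_mono ?_
    rintro _ ⟨⟨j, rfl⟩, hj⟩
    obtain ⟨i, rfl⟩ := hspan j (hFs hj)
    exact ⟨i, rfl⟩
  obtain ⟨k, hk⟩ := exists_eq_smul_of_normal hind hνs (a := a) has (hν _)
  obtain ⟨j₀, hj₀⟩ : ∃ j, j ∉ Set.range s := by
    by_contra! hall
    have := Fintype.card_le_of_surjective s hall
    simp at this
    omega
  have hk0 : k ≠ 0 := by
    rintro rfl
    refine hj₀ (hspan j₀ (haeq j₀ ?_))
    rw [← hk]
    simp
  set b : Bool := decide (0 < k) with hb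
  set ε : ℝ := bif b then (1 : ℝ) else -1 with hε
  have hεk : 0 < ε * k := by
    rcases lt_or_gt_of_ne hk0 with h | h
    · have : b = false := by simp [hb, h.le]
      simp [hε, this, h]
    · have : b = true := by simp [hb, h]
      simp [hε, this, h]
  have hε0 : ε ≠ 0 := left_ne_zero_of_mul hεk.ne'
  have hε2 : ε * ε = 1 := by
    rw [hε]
    cases b <;> simp
  refine ⟨s, b, fun j _ hpos => ?_, ?_⟩
  · have h := hale j
    rw [← hk, inner_smul_left] at h
    rw [← hε, inner_smul_left] at hpos
    simp only [conj_trivial] at h hpos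
    have : k * inner ℝ (ν (ω ∘ s)) (ω j - ω (s 0)) =
        (ε * k) * (ε * inner ℝ (ν (ω ∘ s)) (ω j - ω (s 0))) := by
      linear_combination (-k * inner ℝ (ν (ω ∘ s)) (ω j - ω (s 0))) * hε2
    have := mul_pos hεk hpos
    linarith
  · refine le_trans (by gcongr) (hausdorffMeasure_convexHull_mul_le hm
      (smul_ne_zero hε0 hνs) (ω ∘ s) (fun i => hω _) fun i => ?_)
    rw [inner_smul_left, hν, mul_zero]

lemma sphereUniform_apply (m : ℕ) {T : Set (EuclideanSpace ℝ (Fin (m + 1)))}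
    (hT : MeasurableSet T) :
    sphereUniform (m + 1) T = (μH[(m : ℝ)] (sphere (0 : EuclideanSpace ℝ (Fin (m + 1))) 1))⁻¹ *
      μH[(m : ℝ)] (sphere 0 1 ∩ T) := by
  have hcast : ((m + 1 : ℕ) : ℝ) - 1 = m := by simp
  rw [sphereUniform, hcast, Measure.smul_apply, Measure.restrict_apply hT, Set.inter_comm,
    smul_eq_mul]

lemma isProbabilityMeasure_sphereUniform (m : ℕ)
    (h0 : μH[(m : ℝ)] (sphere (0 : EuclideanSpace ℝ (Fin (m + 1))) 1) ≠ 0)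
    (htop : μH[(m : ℝ)] (sphere (0 : EuclideanSpace ℝ (Fin (m + 1))) 1) ≠ ⊤) :
    IsProbabilityMeasure (sphereUniform (m + 1)) :=
  ⟨by rw [sphereUniform_apply m MeasurableSet.univ, Set.inter_univ, ENNReal.inv_mul_cancel h0 htop]⟩

/-- Almost surely, no point of an i.i.d. uniform sample on the sphere lies on a hyperplane spanned
by other points of the sample. -/
lemma ae_general_position {m N : ℕ} (hm : 1 ≤ m) [IsProbabilityMeasure (sphereUniform (m + 1))]
    {ν : (Fin (m + 1) → EuclideanSpace ℝ (Fin (m + 1))) → EuclideanSpace ℝ (Fin (m + 1))}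
    (hνm : Measurable ν) :
    ∀ᵐ ω ∂Measure.pi (fun _ : Fin N => sphereUniform (m + 1)),
      ∀ (s : Fin (m + 1) ↪ Fin N) (j : Fin N), j ∉ Set.range s → ν (ω ∘ s) ≠ 0 →
        inner ℝ (ν (ω ∘ s)) (ω j - ω (s 0)) ≠ 0 := by
  rw [ae_all_iff]
  intro s
  rw [ae_all_iff]
  intro j
  by_cases hj : j ∈ Set.range s
  · exact ae_of_all _ fun ω h => absurd hj h
  set H : Set ((Fin (m + 1) → EuclideanSpace ℝ (Fin (m + 1))) × EuclideanSpace ℝ (Fin (m + 1))) :=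
    {q | ν q.1 ≠ 0 ∧ inner ℝ (ν q.1) (q.2 - q.1 0) = 0} with hHdef
  have hH : MeasurableSet H := by
    have h1 : MeasurableSet {q : (Fin (m + 1) → EuclideanSpace ℝ (Fin (m + 1))) ×
        EuclideanSpace ℝ (Fin (m + 1)) | ν q.1 = 0} :=
      (hνm.comp measurable_fst) (measurableSet_singleton 0)
    have h2 : Measurable fun q : (Fin (m + 1) → EuclideanSpace ℝ (Fin (m + 1))) ×
        EuclideanSpace ℝ (Fin (m + 1)) => (inner ℝ (ν q.1) (q.2 - q.1 0) : ℝ) := by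
      have h3 : Measurable fun q : (Fin (m + 1) → EuclideanSpace ℝ (Fin (m + 1))) ×
          EuclideanSpace ℝ (Fin (m + 1)) => ν q.1 := hνm.comp measurable_fst
      exact Measurable.inner h3 (by fun_prop)
    exact h1.compl.inter (h2 (measurableSet_singleton 0))
  have hsec : ∀ p, sphereUniform (m + 1) {x | (p, x) ∈ H} = 0 := by
    intro p
    by_cases hp : ν p = 0
    · simp [hHdef, hp]
    · have hpH : MeasurableSet {x | (p, x) ∈ H} := measurable_prodMk_left hH
      rw [sphereUniform_apply m hpH]
      convert mul_zero _
      convert hausdorffMeasure_sphere_inter_hyperplane hm hp (inner ℝ (ν p) (p 0)) using 4 with x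
      simp [hHdef, hp, inner_sub_right, sub_eq_zero]
  have hmain := pi_random_set_missed_le (sphereUniform (m + 1)) s {j} (by simpa using hj)
    hH.compl 1
  rw [tsub_self, Finset.card_singleton, pow_one, nonpos_iff_eq_zero] at hmain
  rw [ae_iff]
  refine measure_mono_null ?_ hmain
  intro ω hω
  have hω' : (ω ∘ s, ω j) ∈ H := by
    by_contra hcon
    exact hω fun _ h1 h2 => hcon ⟨h1, h2⟩
  refine ⟨?_, by simpa using hω'⟩
  have h := prob_compl_eq_one_sub (μ := sphereUniform (m + 1))
    (s := {x | (ω ∘ s, x) ∈ H}) (measurable_prodMk_left hH)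
  rw [hsec, tsub_zero] at h
  exact h.ge

lemma ae_mem_sphere {m N : ℕ} [IsProbabilityMeasure (sphereUniform (m + 1))] :
    ∀ᵐ ω ∂Measure.pi (fun _ : Fin N => sphereUniform (m + 1)),
      ∀ i, ω i ∈ sphere (0 : EuclideanSpace ℝ (Fin (m + 1))) 1 := by
  rw [ae_all_iff]
  intro i
  have h : ∀ᵐ x ∂sphereUniform (m + 1), x ∈ sphere (0 : EuclideanSpace ℝ (Fin (m + 1))) 1 :=
    Measure.ae_smul_measure (ae_restrict_mem isClosed_sphere.measurableSet) _
  exact (measurePreserving_eval (fun _ : Fin N => sphereUniform (m + 1))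
    i).quasiMeasurePreserving.ae h

/-- Expected maximal facet volume, with a free threshold `t` for the measure of empty caps. -/
lemma integral_maxFacetVol_le {m N : ℕ} (hm : 1 ≤ m) (hN : m + 2 ≤ N)
    (h0 : μH[(m : ℝ)] (sphere (0 : EuclideanSpace ℝ (Fin (m + 1))) 1) ≠ 0)
    (htop : μH[(m : ℝ)] (sphere (0 : EuclideanSpace ℝ (Fin (m + 1))) 1) ≠ ⊤)
    {t : ℝ} (ht0 : 0 ≤ t) (ht1 : t ≤ 1) :
    (∫ ω, maxFacetVol (m + 1) (convexHull ℝ (Set.range ω))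
        ∂(Measure.pi fun _ : Fin N => sphereUniform (m + 1))) ≤
      (2 ^ m / m.factorial *
        ((μH[(m : ℝ)] (sphere (0 : EuclideanSpace ℝ (Fin (m + 1))) 1)).toReal /
          (volume (ball (0 : EuclideanSpace ℝ (Fin m)) 1)).toReal)) *
      (t + 2 * (N : ℝ) ^ (m + 1) * (1 - t) ^ (N - (m + 1))) := by
  have hprob := isProbabilityMeasure_sphereUniform m h0 htop
  set M := μH[(m : ℝ)] (sphere (0 : EuclideanSpace ℝ (Fin (m + 1))) 1) with hM
  set V := volume (ball (0 : EuclideanSpace ℝ (Fin m)) 1) with hV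
  have hV0 : 0 < V.toReal :=
    ENNReal.toReal_pos (measure_ball_pos _ _ one_pos).ne' measure_ball_lt_top.ne
  set K : ℝ := 2 ^ m / m.factorial * (M.toReal / V.toReal) with hK
  have hK0 : 0 ≤ K := by positivity
  set P := Measure.pi fun _ : Fin N => sphereUniform (m + 1) with hP
  obtain ⟨ν, hνm, hν, hν0⟩ := exists_measurable_normal m
  set A : Bool → Set ((Fin (m + 1) → EuclideanSpace ℝ (Fin (m + 1))) ×
      EuclideanSpace ℝ (Fin (m + 1))) :=
    fun b => {q | 0 < (inner ℝ ((bif b then (1 : ℝ) else -1) • ν q.1) (q.2 - q.1 0) : ℝ)}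
    with hAdef
  have hA : ∀ b, MeasurableSet (A b) := by
    intro b
    have h1 : Measurable fun q : (Fin (m + 1) → EuclideanSpace ℝ (Fin (m + 1))) ×
        EuclideanSpace ℝ (Fin (m + 1)) => ν q.1 := hνm.comp measurable_fst
    have h2 : Measurable fun q : (Fin (m + 1) → EuclideanSpace ℝ (Fin (m + 1))) ×
        EuclideanSpace ℝ (Fin (m + 1)) => (bif b then (1 : ℝ) else -1) • ν q.1 :=
      h1.const_smul (bif b then (1 : ℝ) else -1)
    exact measurableSet_lt measurable_const (Measurable.inner h2 (by fun_prop))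
  set J : (Fin (m + 1) ↪ Fin N) → Finset (Fin N) := fun s => (Finset.univ.map s)ᶜ with hJdef
  have hJ : ∀ s j, j ∈ J s ↔ j ∉ Set.range s := by simp [hJdef]
  have hJcard : ∀ s, (J s).card = N - (m + 1) := by simp [hJdef, Finset.card_compl]
  set B : (Fin (m + 1) ↪ Fin N) × Bool → Set (Fin N → EuclideanSpace ℝ (Fin (m + 1))) :=
    fun q => {ω | ENNReal.ofReal t ≤ sphereUniform (m + 1) {x | (ω ∘ q.1, x) ∈ A q.2} ∧
      ∀ j ∈ J q.1, (ω ∘ q.1, ω j) ∉ A q.2} with hBdef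
  set D := toMeasurable P (⋃ q, B q) with hD
  have hDP : P.real D ≤ 2 * (N : ℝ) ^ (m + 1) * (1 - t) ^ (N - (m + 1)) := by
    have h1 : P D ≤ ENNReal.ofReal (2 * (N : ℝ) ^ (m + 1) * (1 - t) ^ (N - (m + 1))) := by
      have hcard : (Fintype.card ((Fin (m + 1) ↪ Fin N) × Bool) : ℝ) ≤ 2 * (N : ℝ) ^ (m + 1) := by
        have : Fintype.card ((Fin (m + 1) ↪ Fin N) × Bool) ≤ 2 * N ^ (m + 1) := by
          rw [Fintype.card_prod, Fintype.card_embedding_eq, Fintype.card_bool, mul_comm]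
          simpa using Nat.descFactorial_le_pow N (m + 1)
        exact_mod_cast this
      have h1t : (1 : ENNReal) - ENNReal.ofReal t = ENNReal.ofReal (1 - t) := by
        rw [ENNReal.ofReal_sub _ ht0, ENNReal.ofReal_one]
      rw [hD, measure_toMeasurable]
      calc P (⋃ q, B q) ≤ ∑ q, P (B q) := measure_iUnion_fintype_le _ _
        _ ≤ ∑ _q : (Fin (m + 1) ↪ Fin N) × Bool,
            ENNReal.ofReal ((1 - t) ^ (N - (m + 1))) := by
            refine Finset.sum_le_sum fun q _ => ?_
            refine (pi_random_set_missed_le (sphereUniform (m + 1)) q.1 (J q.1)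
              (fun j hj => (hJ _ _).1 hj) (hA q.2) (ENNReal.ofReal t)).trans ?_
            rw [hJcard, h1t, ENNReal.ofReal_pow (by linarith)]
        _ = ENNReal.ofReal (Fintype.card ((Fin (m + 1) ↪ Fin N) × Bool) *
            (1 - t) ^ (N - (m + 1))) := by
            rw [Finset.sum_const, Finset.card_univ, nsmul_eq_mul,
              ENNReal.ofReal_mul (Nat.cast_nonneg _), ENNReal.ofReal_natCast]
        _ ≤ _ := by
            have : 0 ≤ 1 - t := by linarith
            gcongr
    have : 0 ≤ 1 - t := by linarith
    exact ENNReal.toReal_le_of_le_ofReal (by positivity) h1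
  have hcast : ((m + 1 : ℕ) : ℝ) - 1 = m := by simp
  have hbound : ∀ᵐ ω ∂P, maxFacetVol (m + 1) (convexHull ℝ (Set.range ω)) ≤
      K * t + D.indicator (fun _ => K) ω := by
    filter_upwards [ae_general_position hm hνm, ae_mem_sphere] with ω hgp hω
    have hind : 0 ≤ D.indicator (fun _ => K) ω := Set.indicator_nonneg (fun _ _ => hK0) _
    refine Real.sSup_le ?_ (by positivity)
    rintro _ ⟨F, hF, rfl⟩
    rw [hcast]
    obtain ⟨s, b, hempty, hvol⟩ := hF.exists_empty_cap hm hN hν hν0 hω hgp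
    set T := {x | (ω ∘ s, x) ∈ A b} with hT
    have hTm : MeasurableSet T := measurable_prodMk_left (hA b)
    have hcap : μH[(m : ℝ)] (sphere 0 1 ∩ T) = M * sphereUniform (m + 1) T := by
      rw [sphereUniform_apply m hTm, ← mul_assoc, ENNReal.mul_inv_cancel h0 htop, one_mul]
    have hvol' : (μH[(m : ℝ)] F).toReal ≤ K * (sphereUniform (m + 1)).real T := by
      have hvol2 : μH[(m : ℝ)] F * V ≤
          ENNReal.ofReal (2 ^ m / m.factorial) * (M * sphereUniform (m + 1) T) := by
        rw [← hcap]
        exact hvol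
      have h := ENNReal.toReal_mono (ENNReal.mul_ne_top ENNReal.ofReal_ne_top
        (ENNReal.mul_ne_top htop (measure_ne_top _ _))) hvol2
      rw [ENNReal.toReal_mul, ENNReal.toReal_mul, ENNReal.toReal_mul,
        ENNReal.toReal_ofReal (by positivity), ← le_div_iff₀ hV0] at h
      refine h.trans (le_of_eq ?_)
      rw [hK, Measure.real]
      ring
    by_cases hωD : ω ∈ D
    · rw [Set.indicator_of_mem hωD]
      have := mul_le_mul_of_nonneg_left (measureReal_le_one (μ := sphereUniform (m + 1))
        (s := T)) hK0
      have : 0 ≤ K * t := by positivity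
      linarith
    · have hωB : ω ∉ B (s, b) := fun h =>
        hωD (subset_toMeasurable _ _ (Set.mem_iUnion.2 ⟨_, h⟩))
      have hlt : sphereUniform (m + 1) T < ENNReal.ofReal t := by
        by_contra! hle
        exact hωB ⟨hle, fun j hj => hempty j ((hJ _ _).1 hj)⟩
      have hle : (sphereUniform (m + 1)).real T ≤ t :=
        ENNReal.toReal_le_of_le_ofReal ht0 hlt.le
      rw [Set.indicator_of_notMem hωD, add_zero]
      exact hvol'.trans (mul_le_mul_of_nonneg_left hle hK0)
  have hDm : MeasurableSet D := measurableSet_toMeasurable _ _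
  have hbound_int : Integrable (fun ω => K * t + D.indicator (fun _ => K) ω) P :=
    (integrable_const _).add ((integrable_const K).indicator hDm)
  have hnonneg : ∀ᵐ ω ∂P, 0 ≤ maxFacetVol (m + 1) (convexHull ℝ (Set.range ω)) := by
    refine ae_of_all _ fun ω => Real.sSup_nonneg ?_
    rintro _ ⟨F, -, rfl⟩
    exact ENNReal.toReal_nonneg
  refine (integral_mono_of_nonneg hnonneg hbound_int hbound).trans ?_
  rw [integral_add (integrable_const _) ((integrable_const K).indicator hDm),
    integral_indicator_const _ hDm, integral_const, probReal_univ, smul_eq_mul, smul_eq_mul,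
    one_mul, mul_add, mul_comm (P.real D)]
  gcongr

lemma two_pow_mul_le (m : ℕ) (hm : 1 ≤ m) :
    (2 : ℝ) ^ m * (3 * ((m + 1 : ℕ) : ℝ)) ≤
      (6 : ℝ) ^ (((m + 1 : ℕ) : ℝ) / 2) * √(Real.exp 1 * ((m + 1 : ℕ) : ℝ)) := by
  have hnat : ∀ k : ℕ, 1 ≤ k → (4 : ℝ) ^ k * (9 * (k + 1)) ≤ 2 * 6 ^ (k + 1) := by
    intro k hk
    induction k, hk using Nat.le_induction with
    | base => norm_num
    | succ k hk ih =>
      have hk' : (1 : ℝ) ≤ k := by exact_mod_cast hk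
      have h4 : (0 : ℝ) < 4 ^ k := by positivity
      rw [pow_succ, pow_succ (6 : ℝ) (k + 1)]
      push_cast
      nlinarith
  have he : (2 : ℝ) ≤ Real.exp 1 := by linarith [Real.exp_one_gt_d9]
  refine le_of_sq_le_sq ?_ (by positivity)
  have h6 : ((6 : ℝ) ^ (((m + 1 : ℕ) : ℝ) / 2)) ^ 2 = 6 ^ (m + 1) := by
    rw [← Real.rpow_natCast, ← Real.rpow_mul (by norm_num), ← Real.rpow_natCast]
    congr 1
    push_cast
    ring
  rw [mul_pow _ (√_), h6, Real.sq_sqrt (by positivity)]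
  have h := hnat m hm
  have h4 : ((2 : ℝ) ^ m * (3 * ((m + 1 : ℕ) : ℝ))) ^ 2 =
      4 ^ m * (9 * (m + 1)) * (m + 1) := by
    rw [show (4 : ℝ) = 2 ^ 2 by norm_num, ← pow_mul, mul_comm 2 m, pow_mul]
    push_cast
    ring
  rw [h4]
  calc (4 : ℝ) ^ m * (9 * (m + 1)) * (m + 1) ≤ 2 * 6 ^ (m + 1) * (m + 1) := by gcongr
    _ ≤ Real.exp 1 * 6 ^ (m + 1) * (m + 1) := by gcongr
    _ = _ := by
      push_cast
      ring

/-- The choice of threshold `t = 2 n log N / N`, with `n = m + 1`. -/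
lemma exists_threshold {m N : ℕ} (hm : 1 ≤ m) (hN : m + 2 ≤ N) :
    ∃ t : ℝ, 0 ≤ t ∧ t ≤ 1 ∧ t + 2 * (N : ℝ) ^ (m + 1) * (1 - t) ^ (N - (m + 1)) ≤
      3 * ((m + 1 : ℕ) : ℝ) * (Real.log N / N) := by
  set n : ℝ := ((m + 1 : ℕ) : ℝ) with hn
  have hn2 : 2 ≤ n := by
    rw [hn]
    exact_mod_cast Nat.succ_le_succ hm
  have hN3 : (3 : ℝ) ≤ N := by exact_mod_cast (by omega : 3 ≤ N)
  have hN0 : (0 : ℝ) < N := by linarith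
  have hlog1 : 1 ≤ Real.log N := by
    rw [Real.le_log_iff_exp_le hN0]
    linarith [Real.exp_one_lt_d9]
  by_cases hcase : (N : ℝ) ≤ 3 * n * Real.log N
  · refine ⟨1, zero_le_one, le_rfl, ?_⟩
    rw [sub_self, zero_pow (by omega), mul_zero, add_zero, ← mul_div_assoc, le_div_iff₀ hN0]
    linarith
  · push Not at hcase
    have hN6 : (4 : ℝ) ≤ N := by nlinarith
    have hlog4 : 4 / 3 ≤ Real.log N := by
      have h4 : Real.log 4 ≤ Real.log N := Real.log_le_log (by norm_num) hN6
      have : Real.log 4 = 2 * Real.log 2 := by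
        rw [show (4 : ℝ) = 2 ^ 2 by norm_num, Real.log_pow]
        norm_num
      linarith [Real.log_two_gt_d9]
    have hN4n : 4 * n ≤ N := by nlinarith
    set t : ℝ := 2 * n * Real.log N / N with ht
    have ht0 : 0 ≤ t := by positivity
    have ht1 : t ≤ 1 := by
      rw [ht, div_le_one hN0]
      nlinarith
    refine ⟨t, ht0, ht1, ?_⟩
    have hcastsub : ((N - (m + 1) : ℕ) : ℝ) = N - n := by
      rw [Nat.cast_sub (by omega)]
    have hexp : (n + 1) * Real.log N ≤ t * (N - n) := by
      have h34 : 3 / 4 * (N : ℝ) ≤ N - n := by linarith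
      calc (n + 1) * Real.log N ≤ 3 / 2 * n * Real.log N := by gcongr; linarith
        _ = t * (3 / 4 * N) := by
          rw [ht]
          field_simp
          ring
        _ ≤ t * (N - n) := by gcongr
    have hpow : (1 - t) ^ (N - (m + 1)) ≤ Real.exp (-((n + 1) * Real.log N)) := by
      calc (1 - t) ^ (N - (m + 1)) ≤ Real.exp (-t) ^ (N - (m + 1)) := by
            have : 0 ≤ 1 - t := by linarith
            gcongr
            exact Real.one_sub_le_exp_neg t
        _ = Real.exp (-(t * (N - n))) := by
            rw [← Real.exp_nat_mul, hcastsub]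
            congr 1
            ring
        _ ≤ _ := by
            rw [Real.exp_le_exp]
            linarith
    have hNexp : (N : ℝ) ^ (m + 1) * Real.exp (-((n + 1) * Real.log N)) = 1 / N := by
      rw [Real.exp_neg, mul_comm (n + 1), ← Real.rpow_def_of_pos hN0, hn,
        show ((m + 1 : ℕ) : ℝ) + 1 = ((m + 2 : ℕ) : ℝ) by push_cast; ring, Real.rpow_natCast]
      field_simp
      ring
    calc t + 2 * (N : ℝ) ^ (m + 1) * (1 - t) ^ (N - (m + 1))
        ≤ t + 2 * (N : ℝ) ^ (m + 1) * Real.exp (-((n + 1) * Real.log N)) := by gcongr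
      _ = (2 * n * Real.log N + 2) / N := by
          rw [mul_assoc, hNexp, ht]
          ring
      _ ≤ (3 * n * Real.log N) / N := by
          gcongr
          nlinarith
      _ = _ := by ring

theorem expected_max_facet_upper (n : ℕ) (hn : 2 ≤ n) (N : ℕ) (hN : n + 1 ≤ N) :
    (∫ ω, maxFacetVol n (convexHull ℝ (Set.range ω))
        ∂(Measure.pi fun _ : Fin N => sphereUniform n)) ≤
      ((6 : ℝ) ^ ((n : ℝ) / 2) * Real.sqrt (Real.exp 1 * n) / (Nat.factorial (n - 1) : ℝ) *
          ((μH[(n : ℝ) - 1] (sphere (0 : EuclideanSpace ℝ (Fin n)) 1)).toReal /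
            (volume (ball (0 : EuclideanSpace ℝ (Fin (n - 1))) 1)).toReal)) *
        (Real.log N / N) := by
  obtain ⟨m, rfl⟩ : ∃ m, n = m + 1 := ⟨n - 1, by omega⟩
  have hm : 1 ≤ m := by omega
  have hcast : ((m + 1 : ℕ) : ℝ) - 1 = m := by simp
  rw [hcast, Nat.add_sub_cancel]
  have hlog : 0 ≤ Real.log N / N := by positivity
  by_cases hM : μH[(m : ℝ)] (sphere (0 : EuclideanSpace ℝ (Fin (m + 1))) 1) = 0 ∨
      μH[(m : ℝ)] (sphere (0 : EuclideanSpace ℝ (Fin (m + 1))) 1) = ⊤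
  · have hzero : sphereUniform (m + 1) = 0 := by
      rw [sphereUniform, hcast]
      rcases hM with h | h
      · rw [Measure.restrict_eq_zero.2 h, smul_zero]
      · rw [h, ENNReal.inv_top, zero_smul]
    have hpi : Measure.pi (fun _ : Fin N => sphereUniform (m + 1)) = 0 := by
      have : Nonempty (Fin N) := ⟨⟨0, by omega⟩⟩
      rw [hzero, ← Measure.measure_univ_eq_zero, Measure.pi_univ]
      simp
      omega
    rw [hpi, integral_zero_measure]
    positivity
  · push Not at hM
    obtain ⟨t, ht0, ht1, ht⟩ := exists_threshold hm hN
    refine (integral_maxFacetVol_le hm hN hM.1 hM.2 ht0 ht1).trans ?_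
    set R : ℝ := (μH[(m : ℝ)] (sphere (0 : EuclideanSpace ℝ (Fin (m + 1))) 1)).toReal /
      (volume (ball (0 : EuclideanSpace ℝ (Fin m)) 1)).toReal
    have hR : 0 ≤ R := by positivity
    calc 2 ^ m / m.factorial * R * (t + 2 * (N : ℝ) ^ (m + 1) * (1 - t) ^ (N - (m + 1)))
        ≤ 2 ^ m / m.factorial * R * (3 * ((m + 1 : ℕ) : ℝ) * (Real.log N / N)) := by gcongr
      _ = (2 ^ m * (3 * ((m + 1 : ℕ) : ℝ))) / m.factorial * R * (Real.log N / N) := by ring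
      _ ≤ _ := by
          gcongr ?_ / _ * _ * _
          exact two_pow_mul_le m hm
end

section
/- Let ξ₁,…,ξ_N be i.i.d. uniformly random points on S¹. Then for all sufficiently big N, the expected maximal edge length of the convex hull [ξ₁,…,ξ_N] is at least (1/(2π))·(log N)/N. -/
open MeasureTheory Metric Real

/-- The uniform probability measure on the unit circle `S¹ ⊂ ℝ²`. -/
noncomputable def sphereUniform2 : Measure (EuclideanSpace ℝ (Fin 2)) :=
  (μH[(1 : ℝ)] (sphere (0 : EuclideanSpace ℝ (Fin 2)) 1))⁻¹ •
    (μH[(1 : ℝ)]).restrict (sphere (0 : EuclideanSpace ℝ (Fin 2)) 1)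

/-- `F` is an edge (facet) of the polygon `P ⊆ ℝ²`. -/
def IsEdge (P F : Set (EuclideanSpace ℝ (Fin 2))) : Prop :=
  IsExposed ℝ P F ∧ Module.finrank ℝ (vectorSpan ℝ F) = 1

/-- The maximal edge length of the polygon `P`. -/
noncomputable def maxEdgeLength (P : Set (EuclideanSpace ℝ (Fin 2))) : ℝ :=
  sSup {v : ℝ | ∃ F, IsEdge P F ∧ v = (μH[(1 : ℝ)] F).toReal}

/-- A nondegenerate compact convex set contained in a line is the segment between two of its
extreme points. -/
theorem exists_eq_segment_of_finrank_vectorSpan_eq_one {E : Type*} [NormedAddCommGroup E]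
    [InnerProductSpace ℝ E] {F : Set E} (hcomp : IsCompact F) (hconv : Convex ℝ F)
    (hrank : Module.finrank ℝ (vectorSpan ℝ F) = 1) :
    ∃ a b, a ≠ b ∧ a ∈ F.extremePoints ℝ ∧ b ∈ F.extremePoints ℝ ∧ F = segment ℝ a b := by
  have hne : F.Nonempty := by
    rw [Set.nonempty_iff_ne_empty]
    rintro rfl
    rw [vectorSpan_empty, finrank_bot] at hrank
    exact zero_ne_one hrank
  have : FiniteDimensional ℝ (vectorSpan ℝ F) := Module.finite_of_finrank_eq_succ hrank
  obtain ⟨p, hp⟩ := hne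
  obtain ⟨v, hv⟩ := (collinear_iff_of_mem hp).1 (collinear_iff_finrank_le_one.2 hrank.le)
  have hv0 : v ≠ 0 := by
    rintro rfl
    have hF : F = {p} := by
      refine Set.eq_singleton_iff_unique_mem.2 ⟨hp, fun q hq => ?_⟩
      obtain ⟨r, hr⟩ := hv q hq
      simpa using hr
    rw [hF, vectorSpan_singleton] at hrank
    simp at hrank
  have hvv : 0 < inner ℝ v v := real_inner_self_pos.2 hv0
  have hinj : ∀ r s : ℝ, r • v +ᵥ p = s • v +ᵥ p → r = s := fun r s h =>
    smul_left_injective ℝ hv0 (by simpa using h)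
  have hf : Continuous fun x : E => inner ℝ v x := by fun_prop
  have hmono : ∀ r s : ℝ, inner ℝ v (r • v +ᵥ p) ≤ inner ℝ v (s • v +ᵥ p) → r ≤ s := by
    intro r s h
    simp only [vadd_eq_add, inner_add_right, inner_smul_right, add_le_add_iff_right] at h
    exact le_of_mul_le_mul_right h hvv
  obtain ⟨a, ha, hamin⟩ := hcomp.exists_isMinOn ⟨p, hp⟩ hf.continuousOn
  obtain ⟨b, hb, hbmax⟩ := hcomp.exists_isMaxOn ⟨p, hp⟩ hf.continuousOn
  obtain ⟨s, rfl⟩ := hv a ha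
  obtain ⟨t, rfl⟩ := hv b hb
  have hcomb : ∀ α β r₁ r₂ : ℝ, α + β = 1 →
      α • (r₁ • v +ᵥ p) + β • (r₂ • v +ᵥ p) = (α * r₁ + β * r₂) • v +ᵥ p := by
    intro α β r₁ r₂ h
    obtain rfl : β = 1 - α := by linarith
    simp only [vadd_eq_add]
    module
  have hIcc : ∀ r : ℝ, r • v +ᵥ p ∈ F → s ≤ r ∧ r ≤ t := fun r hr =>
    ⟨hmono _ _ (hamin hr), hmono _ _ (hbmax hr)⟩
  have hseg : F = segment ℝ (s • v +ᵥ p) (t • v +ᵥ p) := by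
    refine Set.Subset.antisymm (fun q hq => ?_) (hconv.segment_subset ha hb)
    obtain ⟨r, rfl⟩ := hv q hq
    have : r ∈ segment ℝ s t := by
      rw [segment_eq_Icc ((hIcc r hq).1.trans (hIcc r hq).2)]
      exact hIcc r hq
    obtain ⟨α, β, hα, hβ, h1, rfl⟩ := this
    exact ⟨α, β, hα, hβ, h1, hcomb α β s t h1⟩
  refine ⟨_, _, ?_, ?_, ?_, hseg⟩
  · intro h
    rw [← h, segment_same] at hseg
    rw [hseg, vectorSpan_singleton] at hrank
    simp at hrank
  · refine mem_extremePoints_iff_left.2 ⟨ha, ?_⟩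
    rintro x₁ h₁ x₂ h₂ ⟨α, β, hα, hβ, h1, h⟩
    obtain ⟨r₁, rfl⟩ := hv x₁ h₁
    obtain ⟨r₂, rfl⟩ := hv x₂ h₂
    rw [hcomb _ _ _ _ h1] at h
    have h3 := hinj _ _ h
    have e1 := (hIcc _ h₁).1
    have e2 := (hIcc _ h₂).1
    have : r₁ = s := by
      refine le_antisymm ?_ e1
      obtain rfl : β = 1 - α := by linarith
      by_contra! hlt
      nlinarith [mul_pos hα (sub_pos.2 hlt), mul_nonneg hβ.le (sub_nonneg.2 e2)]
    rw [this]
  · refine mem_extremePoints_iff_left.2 ⟨hb, ?_⟩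
    rintro x₁ h₁ x₂ h₂ ⟨α, β, hα, hβ, h1, h⟩
    obtain ⟨r₁, rfl⟩ := hv x₁ h₁
    obtain ⟨r₂, rfl⟩ := hv x₂ h₂
    rw [hcomb _ _ _ _ h1] at h
    have h3 := hinj _ _ h
    have e1 := (hIcc _ h₁).2
    have e2 := (hIcc _ h₂).2
    have : r₁ = t := by
      refine le_antisymm e1 ?_
      obtain rfl : β = 1 - α := by linarith
      by_contra! hlt
      nlinarith [mul_pos hα (sub_pos.2 hlt), mul_nonneg hβ.le (sub_nonneg.2 e2)]
    rw [this]

/-- Twice the signed area of the triangle with vertices `a`, `b`, `c`. -/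
def signedArea (a b c : EuclideanSpace ℝ (Fin 2)) : ℝ :=
  (b 0 - a 0) * (c 1 - a 1) - (b 1 - a 1) * (c 0 - a 0)

/-- The pair `(i, j)` spans a supporting line of the configuration `ω`. -/
def IsSupportingPair {ι : Type*} (ω : ι → EuclideanSpace ℝ (Fin 2)) (p : ι × ι) : Prop :=
  ∀ k, 0 ≤ signedArea (ω p.1) (ω p.2) (ω k)

theorem exists_smul_eq_of_mul_eq_mul {v w : EuclideanSpace ℝ (Fin 2)} (hv : v ≠ 0)
    (h : v 1 * w 0 = v 0 * w 1) : ∃ c : ℝ, c • v = w := by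
  have hpos : v 0 ^ 2 + v 1 ^ 2 ≠ 0 := by
    intro h0
    apply hv
    have h1 : v 0 = 0 := by nlinarith [sq_nonneg (v 0), sq_nonneg (v 1)]
    have h2 : v 1 = 0 := by nlinarith [sq_nonneg (v 0), sq_nonneg (v 1)]
    ext i
    fin_cases i <;> simp [h1, h2]
  refine ⟨(v 0 * w 0 + v 1 * w 1) / (v 0 ^ 2 + v 1 ^ 2), ?_⟩
  ext i
  fin_cases i
  · simp only [Fin.zero_eta, PiLp.smul_apply, smul_eq_mul]
    field_simp
    linear_combination (-v 1) * h
  · simp only [Fin.mk_one, PiLp.smul_apply, smul_eq_mul]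
    field_simp
    linear_combination (v 0) * h

theorem exists_isEdge_of_isSupportingPair {ι : Type*} {ω : ι → EuclideanSpace ℝ (Fin 2)}
    {i j : ι} (hij : ω i ≠ ω j) (h : IsSupportingPair ω (i, j)) :
    ∃ F, IsEdge (convexHull ℝ (Set.range ω)) F ∧ segment ℝ (ω i) (ω j) ⊆ F := by
  set a := ω i with ha
  set b := ω j with hb
  let l : StrongDual ℝ (EuclideanSpace ℝ (Fin 2)) :=
    (b 1 - a 1) • EuclideanSpace.proj 0 - (b 0 - a 0) • EuclideanSpace.proj 1
  have hl : ∀ x, l x = (b 1 - a 1) * x 0 - (b 0 - a 0) * x 1 := fun x => by simp [l]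
  have hab : l b = l a := by simp only [hl]; ring
  have hle : ∀ x ∈ convexHull ℝ (Set.range ω), l x ≤ l a := by
    intro x hx
    refine convexHull_min (t := {x | l x ≤ l a}) ?_
      (convex_halfSpace_le l.toLinearMap.isLinear _) hx
    rintro _ ⟨k, rfl⟩
    have := h k
    simp only [signedArea, ← ha, ← hb] at this
    simp only [Set.mem_ofPred_eq, hl]
    linarith
  have haP : a ∈ convexHull ℝ (Set.range ω) := subset_convexHull ℝ _ ⟨i, rfl⟩
  have hbP : b ∈ convexHull ℝ (Set.range ω) := subset_convexHull ℝ _ ⟨j, rfl⟩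
  have hF : IsExposed ℝ (convexHull ℝ (Set.range ω)) (l.toExposed (convexHull ℝ (Set.range ω))) :=
    ContinuousLinearMap.toExposed.isExposed
  have haF : a ∈ l.toExposed (convexHull ℝ (Set.range ω)) := ⟨haP, hle⟩
  have hbF : b ∈ l.toExposed (convexHull ℝ (Set.range ω)) := ⟨hbP, hab ▸ hle⟩
  refine ⟨_, ⟨hF, ?_⟩, (hF.convex (convex_convexHull ℝ _)).segment_subset haF hbF⟩
  have hne : b - a ≠ 0 := sub_ne_zero.2 hij.symm
  have hspan : vectorSpan ℝ (l.toExposed (convexHull ℝ (Set.range ω))) = ℝ ∙ (b - a) := by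
    refine le_antisymm ?_ ?_
    · rw [vectorSpan_def, Submodule.span_le]
      rintro _ ⟨x, hx, y, hy, rfl⟩
      have hxy : l x = l y := le_antisymm (hy.2 x hx.1) (hx.2 y hy.1)
      rw [hl, hl] at hxy
      refine Submodule.mem_span_singleton.2 (exists_smul_eq_of_mul_eq_mul hne ?_)
      simp only [vsub_eq_sub, PiLp.sub_apply]
      linarith
    · rw [Submodule.span_singleton_le_iff_mem]
      exact vsub_mem_vectorSpan ℝ hbF haF
  rw [hspan, finrank_span_singleton hne]

theorem IsEdge.exists_isSupportingPair {ι : Type*} [Finite ι]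
    {ω : ι → EuclideanSpace ℝ (Fin 2)} {F : Set (EuclideanSpace ℝ (Fin 2))}
    (hF : IsEdge (convexHull ℝ (Set.range ω)) F) :
    ∃ p, IsSupportingPair ω p ∧ F = segment ℝ (ω p.1) (ω p.2) := by
  obtain ⟨hexp, hrank⟩ := hF
  have hcomp : IsCompact F := hexp.isCompact ((Set.finite_range ω).isCompact_convexHull ℝ)
  obtain ⟨a, b, hab, ha, hb, hseg⟩ := exists_eq_segment_of_finrank_vectorSpan_eq_one hcomp
    (hexp.convex (convex_convexHull ℝ _)) hrank
  have hsub : F.extremePoints ℝ ⊆ Set.range ω :=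
    hexp.isExtreme.extremePoints_subset_extremePoints.trans extremePoints_convexHull_subset
  obtain ⟨i, rfl⟩ := hsub ha
  obtain ⟨j, rfl⟩ := hsub hb
  obtain ⟨l, hl⟩ := hexp ⟨_, ha.1⟩
  have hmax : ∀ x ∈ F, ∀ k, l (ω k) ≤ l x := by
    intro x hx k
    rw [hl] at hx
    exact hx.2 _ (subset_convexHull ℝ _ ⟨k, rfl⟩)
  have hPsub : ∀ k, ω k ∈ convexHull ℝ (Set.range ω) := fun k =>
    subset_convexHull ℝ _ ⟨k, rfl⟩
  have hlij : l (ω i) = l (ω j) := le_antisymm (hmax _ hb.1 i) (hmax _ ha.1 j)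
  set u := l (EuclideanSpace.single 0 1) with hu
  set w := l (EuclideanSpace.single 1 1) with hw
  have hlx : ∀ x : EuclideanSpace ℝ (Fin 2), l x = u * x 0 + w * x 1 := by
    intro x
    have : x = x 0 • EuclideanSpace.single 0 1 + x 1 • EuclideanSpace.single 1 (1 : ℝ) := by
      ext i
      fin_cases i <;> simp
    conv_lhs => rw [this]
    simp only [map_add, map_smul, smul_eq_mul, hu, hw]
    ring
  have hvv : 0 < (ω j 0 - ω i 0) ^ 2 + (ω j 1 - ω i 1) ^ 2 := by
    by_contra! h0
    apply hab
    have h1 : ω j 0 - ω i 0 = 0 := by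
      nlinarith [sq_nonneg (ω j 0 - ω i 0), sq_nonneg (ω j 1 - ω i 1)]
    have h2 : ω j 1 - ω i 1 = 0 := by
      nlinarith [sq_nonneg (ω j 0 - ω i 0), sq_nonneg (ω j 1 - ω i 1)]
    ext n
    fin_cases n
    · simpa using (sub_eq_zero.1 h1).symm
    · simpa using (sub_eq_zero.1 h2).symm
  -- `l` is a multiple of the signed area functional of the edge
  have key : ∀ k, ((ω j 0 - ω i 0) ^ 2 + (ω j 1 - ω i 1) ^ 2) * (l (ω k) - l (ω i)) =
      (w * (ω j 0 - ω i 0) - u * (ω j 1 - ω i 1)) * signedArea (ω i) (ω j) (ω k) := by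
    intro k
    simp only [hlx, signedArea] at hlij ⊢
    linear_combination (-((ω j 0 - ω i 0) * (ω k 0 - ω i 0) +
      (ω j 1 - ω i 1) * (ω k 1 - ω i 1))) * hlij
  have hsgn : ∀ k, (w * (ω j 0 - ω i 0) - u * (ω j 1 - ω i 1)) *
      signedArea (ω i) (ω j) (ω k) ≤ 0 := by
    intro k
    rw [← key k]
    exact mul_nonpos_of_nonneg_of_nonpos hvv.le (sub_nonpos.2 (hmax _ ha.1 k))
  rcases lt_trichotomy (w * (ω j 0 - ω i 0) - u * (ω j 1 - ω i 1)) 0 with hc | hc | hc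
  · exact ⟨(i, j), fun k => by have := hsgn k; by_contra! h; nlinarith, hseg⟩
  · refine ⟨(i, j), fun k => le_of_eq ?_, hseg⟩
    have hk : ω k ∈ F := by
      rw [hl]
      have hconst : ∀ m, l (ω m) = l (ω i) := by
        intro m
        have := key m
        rw [hc, zero_mul] at this
        have := (mul_eq_zero.1 this).resolve_left hvv.ne'
        linarith
      refine ⟨hPsub k, fun y hy => ?_⟩
      rw [hconst k]
      rw [hl] at ha
      exact ha.1.2 y hy
    rw [hseg] at hk
    obtain ⟨α, β, -, -, h1, h⟩ := hk
    rw [← h]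
    obtain rfl : α = 1 - β := by linarith
    simp only [signedArea, PiLp.add_apply, PiLp.smul_apply, smul_eq_mul]
    ring
  · refine ⟨(j, i), fun k => ?_, by rw [hseg, segment_symm]⟩
    have h1 := hsgn k
    have h2 : signedArea (ω j) (ω i) (ω k) = -signedArea (ω i) (ω j) (ω k) := by
      simp only [signedArea]
      ring
    simp only [h2]
    by_contra! h
    nlinarith

open scoped Classical in
/-- The distance between the points of a supporting pair, and `0` for other pairs. -/
noncomputable def supportingDist {ι : Type*} (ω : ι → EuclideanSpace ℝ (Fin 2)) (p : ι × ι) : ℝ :=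
  if IsSupportingPair ω p then dist (ω p.1) (ω p.2) else 0

theorem supportingDist_nonneg {ι : Type*} (ω : ι → EuclideanSpace ℝ (Fin 2)) (p : ι × ι) :
    0 ≤ supportingDist ω p := by
  unfold supportingDist
  split_ifs
  exacts [dist_nonneg, le_rfl]

theorem toReal_hausdorffMeasure_segment (a b : EuclideanSpace ℝ (Fin 2)) :
    (μH[(1 : ℝ)] (segment ℝ a b)).toReal = dist a b := by
  rw [hausdorffMeasure_segment, edist_dist, ENNReal.toReal_ofReal dist_nonneg]

theorem maxEdgeLength_nonneg (P : Set (EuclideanSpace ℝ (Fin 2))) : 0 ≤ maxEdgeLength P := by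
  refine Real.sSup_nonneg ?_
  rintro _ ⟨F, -, rfl⟩
  exact ENNReal.toReal_nonneg

theorem maxEdgeLength_convexHull_range {ι : Type*} [Finite ι]
    (ω : ι → EuclideanSpace ℝ (Fin 2)) :
    maxEdgeLength (convexHull ℝ (Set.range ω)) = ⨆ p : ι × ι, supportingDist ω p := by
  have hbdd : BddAbove (Set.range (supportingDist ω)) := (Set.finite_range _).bddAbove
  have hle : ∀ F, IsEdge (convexHull ℝ (Set.range ω)) F →
      (μH[(1 : ℝ)] F).toReal ≤ ⨆ p : ι × ι, supportingDist ω p := by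
    intro F hF
    obtain ⟨p, hp, rfl⟩ := hF.exists_isSupportingPair
    rw [toReal_hausdorffMeasure_segment]
    refine le_trans ?_ (le_ciSup hbdd p)
    rw [supportingDist, if_pos hp]
  refine le_antisymm (Real.sSup_le ?_ (Real.iSup_nonneg (supportingDist_nonneg ω)))
    (Real.iSup_le ?_ (maxEdgeLength_nonneg _))
  · rintro _ ⟨F, hF, rfl⟩
    exact hle F hF
  · rintro ⟨i, j⟩
    have hnn := maxEdgeLength_nonneg (convexHull ℝ (Set.range ω))
    unfold supportingDist
    split_ifs with h
    · rcases eq_or_ne (ω i) (ω j) with hij | hij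
      · simpa [hij] using hnn
      obtain ⟨F, hF, hsub⟩ := exists_isEdge_of_isSupportingPair hij h
      refine le_trans ?_ (le_csSup ?_ ⟨F, hF, rfl⟩)
      · obtain ⟨p, -, hp⟩ := hF.exists_isSupportingPair
        rw [← toReal_hausdorffMeasure_segment]
        refine ENNReal.toReal_mono ?_ (measure_mono hsub)
        rw [hp, hausdorffMeasure_segment]
        exact edist_ne_top _ _
      · refine ⟨⨆ p : ι × ι, supportingDist ω p, ?_⟩
        rintro _ ⟨F, hF, rfl⟩
        exact hle F hF
    · exact hnn

theorem measurable_maxEdgeLength_convexHull_range (ι : Type*) [Finite ι] :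
    Measurable fun ω : ι → EuclideanSpace ℝ (Fin 2) =>
      maxEdgeLength (convexHull ℝ (Set.range ω)) := by
  have := Fintype.ofFinite ι
  simp only [maxEdgeLength_convexHull_range]
  refine Measurable.iSup fun p => Measurable.ite ?_ ?_ measurable_const
  · simp only [IsSupportingPair, Set.ofPred_forall]
    refine MeasurableSet.iInter fun k => (isClosed_le continuous_const ?_).measurableSet
    unfold signedArea
    fun_prop
  · have : Continuous fun ω : ι → EuclideanSpace ℝ (Fin 2) => dist (ω p.1) (ω p.2) := by fun_prop
    exact this.measurable

/-- The point of the unit circle at angle `t`. -/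
noncomputable def circlePoint (t : ℝ) : EuclideanSpace ℝ (Fin 2) := !₂[cos t, sin t]

@[simp] theorem circlePoint_zero (t : ℝ) : circlePoint t 0 = cos t := rfl

@[simp] theorem circlePoint_one (t : ℝ) : circlePoint t 1 = sin t := rfl

theorem inner_circlePoint (s t : ℝ) :
    inner ℝ (circlePoint s) (circlePoint t) = cos (s - t) := by
  simp [PiLp.inner_apply, Fin.sum_univ_two, cos_sub]
  ring

theorem norm_circlePoint (t : ℝ) : ‖circlePoint t‖ = 1 := by
  simp [EuclideanSpace.norm_eq, Fin.sum_univ_two]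

theorem dist_circlePoint (s t : ℝ) :
    dist (circlePoint s) (circlePoint t) = 2 * |sin ((s - t) / 2)| := by
  rw [EuclideanSpace.dist_eq, Fin.sum_univ_two]
  simp only [circlePoint_zero, circlePoint_one, Real.dist_eq, sq_abs, cos_sub_cos, sin_sub_sin]
  rw [show (2 : ℝ) * |sin ((s - t) / 2)| = |2 * sin ((s - t) / 2)| by rw [abs_mul, abs_two],
    ← sqrt_sq_eq_abs]
  congr 1
  linear_combination (4 * sin ((s - t) / 2) ^ 2) * sin_sq_add_cos_sq ((s + t) / 2)

theorem dist_circlePoint_le (s t : ℝ) : dist (circlePoint s) (circlePoint t) ≤ |s - t| := by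
  have h : |sin ((s - t) / 2)| ≤ |(s - t) / 2| := abs_sin_le_abs
  rw [dist_circlePoint]
  rw [abs_div, abs_two] at h
  linarith

theorem exists_circlePoint_eq {x : EuclideanSpace ℝ (Fin 2)}
    (hx : x ∈ sphere (0 : EuclideanSpace ℝ (Fin 2)) 1) (φ : ℝ) :
    ∃ t ∈ Set.Ico φ (φ + 2 * π), circlePoint t = x := by
  have hx1 : x 0 ^ 2 + x 1 ^ 2 = 1 := by
    have := mem_sphere_zero_iff_norm.1 hx
    rw [EuclideanSpace.norm_eq, sqrt_eq_one, Fin.sum_univ_two] at this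
    simpa using this
  have hz : ‖(⟨x 0, x 1⟩ : ℂ)‖ = 1 := by
    rw [← sq_eq_sq₀ (norm_nonneg _) zero_le_one, Complex.sq_norm, Complex.normSq_mk]
    linarith
  set θ := Complex.arg ⟨x 0, x 1⟩ with hθ
  have hcos : cos θ = x 0 := by
    have := Complex.norm_mul_cos_arg ⟨x 0, x 1⟩
    rwa [hz, one_mul] at this
  have hsin : sin θ = x 1 := by
    have := Complex.norm_mul_sin_arg ⟨x 0, x 1⟩
    rwa [hz, one_mul] at this
  refine ⟨toIcoMod two_pi_pos φ θ, toIcoMod_mem_Ico _ _ _, ?_⟩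
  have h : toIcoMod two_pi_pos φ θ = θ - toIcoDiv two_pi_pos φ θ * (2 * π) := by
    rw [toIcoMod, zsmul_eq_mul]
  ext i
  fin_cases i
  · simpa only [Fin.zero_eta, circlePoint_zero, h, cos_sub_int_mul_two_pi] using hcos
  · simpa only [Fin.mk_one, circlePoint_one, h, sin_sub_int_mul_two_pi] using hsin

theorem hausdorffMeasure_sphere_ne_top :
    μH[(1 : ℝ)] (sphere (0 : EuclideanSpace ℝ (Fin 2)) 1) ≠ ⊤ := by
  have hlip : LipschitzWith 1 circlePoint :=
    LipschitzWith.of_dist_le_mul fun s t => by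
      simpa [Real.dist_eq] using dist_circlePoint_le s t
  have hsub : sphere (0 : EuclideanSpace ℝ (Fin 2)) 1 ⊆
      circlePoint '' Set.Ico 0 (0 + 2 * π) := fun x hx => exists_circlePoint_eq hx 0
  refine ne_top_of_le_ne_top ?_
    ((measure_mono hsub).trans (hlip.hausdorffMeasure_image_le zero_le_one _))
  rw [hausdorffMeasure_real, Real.volume_Ico]
  exact ENNReal.mul_ne_top (by simp) ENNReal.ofReal_ne_top

theorem hausdorffMeasure_sphere_ne_zero :
    μH[(1 : ℝ)] (sphere (0 : EuclideanSpace ℝ (Fin 2)) 1) ≠ 0 := by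
  have hlip : LipschitzWith 1 fun x : EuclideanSpace ℝ (Fin 2) => x 0 :=
    LipschitzWith.of_dist_le_mul fun x y => by
      simpa [Real.dist_eq, dist_eq_norm] using PiLp.norm_apply_le (x - y) 0
  have hsub : Set.Icc (-1 : ℝ) 1 ⊆
      (fun x : EuclideanSpace ℝ (Fin 2) => x 0) '' sphere (0 : EuclideanSpace ℝ (Fin 2)) 1 :=
    fun x hx => ⟨circlePoint (arccos x), by simp [norm_circlePoint],
      by simp [cos_arccos hx.1 hx.2]⟩
  intro h0
  have := (measure_mono hsub).trans (hlip.hausdorffMeasure_image_le zero_le_one _)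
  rw [h0, hausdorffMeasure_real, Real.volume_Icc] at this
  norm_num at this

instance isProbabilityMeasure_sphereUniform2 : IsProbabilityMeasure sphereUniform2 := by
  constructor
  rw [sphereUniform2, Measure.smul_apply, Measure.restrict_apply_univ, smul_eq_mul,
    ENNReal.inv_mul_cancel hausdorffMeasure_sphere_ne_zero hausdorffMeasure_sphere_ne_top]

theorem ae_sphereUniform2_mem_sphere :
    ∀ᵐ x ∂sphereUniform2, x ∈ sphere (0 : EuclideanSpace ℝ (Fin 2)) 1 :=
  Measure.ae_smul_measure (ae_restrict_mem isClosed_sphere.measurableSet) _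

theorem sphereUniform2_preimage (e : EuclideanSpace ℝ (Fin 2) ≃ₗᵢ[ℝ] EuclideanSpace ℝ (Fin 2))
    {s : Set (EuclideanSpace ℝ (Fin 2))} (hs : MeasurableSet s) :
    sphereUniform2 (e ⁻¹' s) = sphereUniform2 s := by
  have hsph : e ⁻¹' sphere (0 : EuclideanSpace ℝ (Fin 2)) 1 = sphere 0 1 := by
    ext x
    simp
  rw [sphereUniform2, Measure.smul_apply, Measure.smul_apply, Measure.restrict_apply hs,
    Measure.restrict_apply (e.continuous.measurable hs)]
  have h := e.toIsometryEquiv.hausdorffMeasure_preimage 1 (s ∩ sphere 0 1)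
  rw [LinearIsometryEquiv.coe_toIsometryEquiv, Set.preimage_inter, hsph] at h
  rw [h]

/-- The open half-plane `{x | h < ⟪u, x⟫}`, cutting a cap from the unit circle. -/
def openCap (u : EuclideanSpace ℝ (Fin 2)) (h : ℝ) : Set (EuclideanSpace ℝ (Fin 2)) :=
  {x | h < inner ℝ u x}

theorem measurableSet_openCap (u : EuclideanSpace ℝ (Fin 2)) (h : ℝ) :
    MeasurableSet (openCap u h) :=
  (isOpen_lt continuous_const (by fun_prop)).measurableSet

theorem sphereUniform2_openCap_eq {u v : EuclideanSpace ℝ (Fin 2)} (huv : ‖u‖ = ‖v‖) (h : ℝ) :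
    sphereUniform2 (openCap u h) = sphereUniform2 (openCap v h) := by
  set e := (ℝ ∙ (u - v))ᗮ.reflection with he
  have heu : e u = v := Submodule.reflection_sub huv
  rw [← sphereUniform2_preimage e (measurableSet_openCap v h)]
  congr 1
  ext x
  simp only [openCap, Set.mem_preimage, Set.mem_ofPred_eq]
  rw [← heu, e.inner_map_map]

theorem exists_int_abs_sub_lt_of_cos_lt_cos {x α : ℝ} (hα : 0 ≤ α) (h : cos α < cos x) :
    ∃ n : ℤ, |x - n * (2 * π)| < α := by
  refine ⟨toIcoDiv two_pi_pos (-π) x, ?_⟩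
  have hmem := toIcoMod_mem_Ico two_pi_pos (-π) x
  rw [toIcoMod, zsmul_eq_mul] at hmem
  rw [← cos_sub_int_mul_two_pi x (toIcoDiv two_pi_pos (-π) x), ← cos_abs (x - _)] at h
  by_contra! hle
  refine h.not_ge (cos_le_cos_of_nonneg_of_le_pi hα ?_ hle)
  exact abs_le.2 ⟨hmem.1, by linarith [hmem.2]⟩

/-- The direction of the `m`-th of `M` equally spaced points of the circle. -/
noncomputable def equalDirection (M : ℕ) (m : Fin M) : EuclideanSpace ℝ (Fin 2) :=
  circlePoint (2 * π * m / M)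

theorem notMem_openCap_of_mem_openCap {M : ℕ} {m n : Fin M} (hmn : m ≠ n)
    {x : EuclideanSpace ℝ (Fin 2)} (hx : x ∈ sphere (0 : EuclideanSpace ℝ (Fin 2)) 1)
    (hm : x ∈ openCap (equalDirection M m) (cos (π / M))) :
    x ∉ openCap (equalDirection M n) (cos (π / M)) := by
  intro hn
  obtain ⟨t, -, rfl⟩ := exists_circlePoint_eq hx 0
  simp only [openCap, equalDirection, Set.mem_ofPred_eq, inner_circlePoint] at hm hn
  have hM : (0 : ℝ) < M := by exact_mod_cast m.pos
  obtain ⟨a, ha⟩ := exists_int_abs_sub_lt_of_cos_lt_cos (by positivity) hm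
  obtain ⟨b, hb⟩ := exists_int_abs_sub_lt_of_cos_lt_cos (by positivity) hn
  have hlt : |2 * π * m / M - 2 * π * n / M - (a - b) * (2 * π)| < 2 * π / M := by
    have := abs_sub (2 * π * m / M - t - a * (2 * π)) (2 * π * n / M - t - b * (2 * π))
    calc _ = |(2 * π * m / M - t - a * (2 * π)) - (2 * π * n / M - t - b * (2 * π))| := by
          congr 1
          ring
      _ < π / M + π / M := this.trans_lt (add_lt_add ha hb)
      _ = 2 * π / M := by ring
  rw [show 2 * π * m / M - 2 * π * n / M - (a - b) * (2 * π) =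
      (2 * π / M) * (((m : ℤ) - (n : ℤ) - (a - b) * M : ℤ) : ℝ) by
        push_cast
        field_simp, abs_mul, abs_of_pos (by positivity)] at hlt
  have h1 : |(((m : ℤ) - (n : ℤ) - (a - b) * M : ℤ) : ℝ)| < 1 := by
    have : 0 < 2 * π / M := by positivity
    exact lt_of_mul_lt_mul_left (by rwa [mul_one]) this.le
  rw [← Int.cast_abs, ← Int.cast_one, Int.cast_lt, Int.abs_lt_one_iff] at h1
  apply hmn
  have hmod : (m : ℤ) ≡ n [ZMOD M] := by
    refine (Int.modEq_iff_dvd.2 ⟨-(a - b), ?_⟩)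
    linarith
  have hm' : (m : ℕ) ≡ n [MOD M] := Int.natCast_modEq_iff.1 hmod
  exact Fin.ext (hm'.eq_of_lt_of_lt m.2 n.2)

theorem aedisjoint_openCap_equalDirection {M : ℕ} {m n : Fin M} (hmn : m ≠ n) :
    AEDisjoint sphereUniform2 (openCap (equalDirection M m) (cos (π / M)))
      (openCap (equalDirection M n) (cos (π / M))) := by
  refine measure_mono_null (t := (sphere (0 : EuclideanSpace ℝ (Fin 2)) 1)ᶜ) ?_
    ae_sphereUniform2_mem_sphere
  intro x hx hs
  exact notMem_openCap_of_mem_openCap hmn hs hx.1 hx.2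

theorem measureReal_openCap_equalDirection_eq {M : ℕ} (m n : Fin M) (h : ℝ) :
    sphereUniform2.real (openCap (equalDirection M m) h) =
      sphereUniform2.real (openCap (equalDirection M n) h) := by
  rw [Measure.real, Measure.real, sphereUniform2_openCap_eq]
  rw [equalDirection, equalDirection, norm_circlePoint, norm_circlePoint]

theorem measureReal_openCap_equalDirection_le {M : ℕ} (m : Fin M) :
    sphereUniform2.real (openCap (equalDirection M m) (cos (π / M))) ≤ 1 / M := by
  let A : Fin M → Set (EuclideanSpace ℝ (Fin 2)) :=
    fun n => openCap (equalDirection M n) (cos (π / M))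
  have heq : ∀ n, sphereUniform2.real (A n) = sphereUniform2.real (A m) := fun n =>
    measureReal_openCap_equalDirection_eq n m _
  have hdisj : Pairwise (Function.onFun (AEDisjoint sphereUniform2) A) :=
    fun i j hij => aedisjoint_openCap_equalDirection hij
  have hsum : ∑ n, sphereUniform2.real (A n) ≤ 1 := by
    simp only [Measure.real]
    rw [← ENNReal.toReal_sum fun n _ => measure_ne_top _ _,
      ← tsum_fintype (L := SummationFilter.unconditional _), ← measure_iUnion₀ hdisj
      fun n => (measurableSet_openCap _ _).nullMeasurableSet]
    exact measureReal_le_one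
  have hM : (0 : ℝ) < M := by exact_mod_cast m.pos
  rw [Finset.sum_congr rfl fun n _ => heq n] at hsum
  simp only [Finset.sum_const, Finset.card_univ, Fintype.card_fin, nsmul_eq_mul] at hsum
  rw [le_div_iff₀ hM]
  linarith

theorem one_fourth_le_measureReal_openCap {u : EuclideanSpace ℝ (Fin 2)} (hu : ‖u‖ = 1) :
    1 / 4 ≤ sphereUniform2.real (openCap u (1 / 2)) := by
  let A : Fin 4 → Set (EuclideanSpace ℝ (Fin 2)) :=
    fun n => openCap (circlePoint (n * (π / 2))) (1 / 2)
  have heq : ∀ n, sphereUniform2.real (A n) = sphereUniform2.real (openCap u (1 / 2)) := by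
    intro n
    rw [Measure.real, Measure.real, sphereUniform2_openCap_eq]
    rw [norm_circlePoint, hu]
  have hcover : sphereUniform2.real (⋃ n, A n) = 1 := by
    rw [Measure.real, prob_compl_eq_zero_iff (MeasurableSet.iUnion fun n =>
      measurableSet_openCap _ _) |>.1, ENNReal.toReal_one]
    refine measure_mono_null (t := (sphere (0 : EuclideanSpace ℝ (Fin 2)) 1)ᶜ) ?_
      ae_sphereUniform2_mem_sphere
    rw [Set.compl_subset_compl]
    intro x hx
    obtain ⟨t, -, rfl⟩ := exists_circlePoint_eq hx 0
    simp only [Set.mem_iUnion, openCap, Set.mem_ofPred_eq, inner_circlePoint]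
    by_contra! hcon
    have h0 := hcon 0
    have h1 := hcon 1
    have h2 := hcon 2
    have h3 := hcon 3
    norm_num at h0 h1 h2 h3
    rw [cos_pi_div_two_sub] at h1
    rw [show 2 * (π / 2) - t = π - t by ring, cos_pi_sub] at h2
    rw [show 3 * (π / 2) - t = (π / 2 - t) + π by ring, cos_add_pi, cos_pi_div_two_sub] at h3
    nlinarith [sin_sq_add_cos_sq t]
  have := measureReal_iUnion_fintype_le (μ := sphereUniform2) A
  rw [hcover] at this
  simp only [heq, Finset.sum_const, Finset.card_univ, Fintype.card_fin, nsmul_eq_mul] at this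
  push_cast at this
  linarith

theorem signedArea_circlePoint (r s t : ℝ) :
    signedArea (circlePoint r) (circlePoint s) (circlePoint t) =
      4 * sin ((s - r) / 2) * sin ((t - r) / 2) * sin ((t - s) / 2) := by
  have h : sin ((t - s) / 2) =
      sin ((t + r) / 2) * cos ((s + r) / 2) - cos ((t + r) / 2) * sin ((s + r) / 2) := by
    rw [← sin_sub]
    congr 1
    ring
  simp only [signedArea, circlePoint_zero, circlePoint_one, cos_sub_cos, sin_sub_sin, h]
  ring

/-- If a cap of half-angle `α` contains none of the points of a configuration on the circle, and
two of the points are far apart, then the gap around the cap is bridged by a supporting pair. -/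
theorem exists_isSupportingPair_of_openCap {ι : Type*} [Finite ι]
    {ω : ι → EuclideanSpace ℝ (Fin 2)}
    (hω : ∀ k, ω k ∈ sphere (0 : EuclideanSpace ℝ (Fin 2)) 1) {φ α : ℝ} (hα : 0 ≤ α)
    (hα' : α ≤ 1 / 2) (hcap : ∀ k, ω k ∉ openCap (circlePoint φ) (cos α)) {a b : ι}
    (hab : 1 ≤ dist (ω a) (ω b)) :
    ∃ p, IsSupportingPair ω p ∧ 2 * sin α ≤ dist (ω p.1) (ω p.2) := by
  choose t ht hωt using fun k => exists_circlePoint_eq (hω k) φ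
  have : Nonempty ι := ⟨a⟩
  have hpi := pi_gt_three
  have hgap : ∀ k, φ + α ≤ t k ∧ t k ≤ φ + 2 * π - α := by
    intro k
    have hk := hcap k
    rw [← hωt k] at hk
    simp only [openCap, Set.mem_ofPred_eq, inner_circlePoint, not_lt] at hk
    obtain ⟨h1, h2⟩ := ht k
    constructor <;> by_contra! hlt
    · rw [← cos_neg, neg_sub] at hk
      exact hk.not_gt (cos_lt_cos_of_nonneg_of_le_pi (by linarith) (by linarith) (by linarith))
    · rw [← cos_add_two_pi] at hk
      exact hk.not_gt (cos_lt_cos_of_nonneg_of_le_pi (by linarith) (by linarith) (by linarith))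
  obtain ⟨i, hi⟩ := Finite.exists_max t
  obtain ⟨j, hj⟩ := Finite.exists_min t
  have hspread : 1 ≤ t i - t j := by
    rw [← hωt a, ← hωt b] at hab
    refine (hab.trans (dist_circlePoint_le _ _)).trans (abs_le.2 ⟨?_, ?_⟩)
    · linarith [hi b, hj a]
    · linarith [hi a, hj b]
  refine ⟨(i, j), fun k => ?_, ?_⟩
  · simp only
    rw [← hωt i, ← hωt j, ← hωt k, signedArea_circlePoint]
    have hi1 := (hgap i).2
    have hj1 := (hgap j).1
    have hik := hi k
    have hjk := hj k
    have e1 : sin ((t j - t i) / 2) ≤ 0 :=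
      sin_nonpos_of_nonpos_of_neg_pi_le (by linarith) (by linarith)
    have e2 : sin ((t k - t i) / 2) ≤ 0 :=
      sin_nonpos_of_nonpos_of_neg_pi_le (by linarith) (by linarith)
    have e3 : 0 ≤ sin ((t k - t j) / 2) :=
      sin_nonneg_of_nonneg_of_le_pi (by linarith) (by linarith)
    have := mul_nonneg (mul_nonneg_of_nonpos_of_nonpos e1 e2) e3
    linarith
  · simp only
    rw [← hωt i, ← hωt j, dist_circlePoint]
    have hi1 := (hgap i).2
    have hj1 := (hgap j).1
    refine mul_le_mul_of_nonneg_left (le_trans ?_ (le_abs_self _)) zero_le_two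
    rcases le_total ((t i - t j) / 2) (π / 2) with h | h
    · exact sin_le_sin_of_le_of_le_pi_div_two (by linarith) h (by linarith)
    · rw [← sin_pi_sub ((t i - t j) / 2)]
      exact sin_le_sin_of_le_of_le_pi_div_two (by linarith) (by linarith) (by linarith)

/-- Second moment lower bound for a union of equiprobable, pairwise negatively correlated events. -/
theorem one_sub_le_measureReal_iUnion {Ω ι : Type*} [MeasurableSpace Ω] [Fintype ι] [Nonempty ι]
    {P : Measure Ω} [IsProbabilityMeasure P] {E : ι → Set Ω} (hE : ∀ i, MeasurableSet (E i))
    {q : ℝ} (hq : 0 < q) (hEq : ∀ i, P.real (E i) = q)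
    (hpair : ∀ i j, i ≠ j → P.real (E i ∩ E j) ≤ q ^ 2) :
    1 - 1 / (Fintype.card ι * q) ≤ P.real (⋃ i, E i) := by
  classical
  set c : ℝ := (Fintype.card ι : ℝ) with hc
  have hcpos : 0 < c := by
    rw [hc]
    exact_mod_cast Fintype.card_pos
  set X : Ω → ℝ := fun x => ∑ i, (E i).indicator 1 x with hX
  have hindicator : ∀ s : Set Ω, MeasurableSet s → Integrable (s.indicator (1 : Ω → ℝ)) P := fun s hs =>
    (integrable_const (1 : ℝ)).indicator hs
  have hXint : Integrable X P := integrable_finsetSum _ fun i _ => hindicator _ (hE i)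
  have hX2 : ∀ x, X x ^ 2 = ∑ i, ∑ j, (E i ∩ E j).indicator 1 x := by
    intro x
    simp only [hX, sq, Finset.sum_mul_sum, Set.inter_indicator_one, Pi.mul_apply]
  have hX2int : Integrable (fun x => X x ^ 2) P := by
    simp only [hX2]
    exact integrable_finsetSum _ fun i _ => integrable_finsetSum _ fun j _ =>
      hindicator _ ((hE i).inter (hE j))
  have hEX : ∫ x, X x ∂P = c * q := by
    simp only [hX]
    rw [integral_finsetSum _ fun i _ => hindicator _ (hE i)]
    simp [integral_indicator_one (hE _), hEq, hc]
  have hEX2 : ∫ x, X x ^ 2 ∂P ≤ c * q + (c * q) ^ 2 := by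
    simp only [hX2]
    rw [integral_finsetSum _ fun i _ => integrable_finsetSum _ fun j _ =>
      hindicator _ ((hE i).inter (hE j))]
    have hrow : ∀ i, ∫ x, ∑ j, (E i ∩ E j).indicator (1 : Ω → ℝ) x ∂P ≤ q + c * q ^ 2 := by
      intro i
      rw [integral_finsetSum _ fun j _ => hindicator _ ((hE i).inter (hE j))]
      calc ∑ j, ∫ x, (E i ∩ E j).indicator (1 : Ω → ℝ) x ∂P
          ≤ ∑ j, ((if i = j then q else 0) + q ^ 2) := by
            refine Finset.sum_le_sum fun j _ => ?_
            rw [integral_indicator_one ((hE i).inter (hE j))]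
            split_ifs with hij
            · rw [← hij, Set.inter_self, hEq]
              nlinarith
            · linarith [hpair i j hij]
        _ = q + c * q ^ 2 := by
            rw [Finset.sum_add_distrib]
            simp [hc]
    calc ∑ i, ∫ x, ∑ j, (E i ∩ E j).indicator (1 : Ω → ℝ) x ∂P
        ≤ ∑ _i : ι, (q + c * q ^ 2) := Finset.sum_le_sum fun i _ => hrow i
      _ = c * q + (c * q) ^ 2 := by
          simp [hc]
          ring
  have hle : ∀ x, 2 * (c * q)⁻¹ * X x - ((c * q)⁻¹) ^ 2 * X x ^ 2 ≤
      (⋃ i, E i).indicator 1 x := by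
    intro x
    by_cases hx : x ∈ ⋃ i, E i
    · rw [Set.indicator_of_mem hx, Pi.one_apply]
      nlinarith [sq_nonneg ((c * q)⁻¹ * X x - 1)]
    · rw [Set.indicator_of_notMem hx]
      have : X x = 0 := Finset.sum_eq_zero fun i _ =>
        Set.indicator_of_notMem (fun hi => hx (Set.mem_iUnion.2 ⟨i, hi⟩)) _
      simp [this]
  have hU : MeasurableSet (⋃ i, E i) := MeasurableSet.iUnion hE
  have hmono := integral_mono ((hXint.const_mul _).sub (hX2int.const_mul _)) (hindicator _ hU) hle
  rw [integral_indicator_one hU] at hmono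
  refine le_trans ?_ hmono
  simp only [Pi.sub_apply]
  rw [integral_sub (hXint.const_mul _) (hX2int.const_mul _), integral_const_mul,
    integral_const_mul, hEX]
  have hcq : 0 < c * q := by positivity
  have h2 : ((c * q)⁻¹) ^ 2 * ∫ x, X x ^ 2 ∂P ≤ ((c * q)⁻¹) ^ 2 * (c * q + (c * q) ^ 2) :=
    mul_le_mul_of_nonneg_left hEX2 (by positivity)
  have h3 : ((c * q)⁻¹) ^ 2 * (c * q + (c * q) ^ 2) = 1 / (c * q) + 1 := by
    field_simp
  have h4 : 2 * (c * q)⁻¹ * (c * q) = 2 := by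
    field_simp
  linarith

theorem setOf_forall_notMem_eq_pi {ι α : Type*} (s : Set α) :
    {ω : ι → α | ∀ k, ω k ∉ s} = Set.univ.pi fun _ => sᶜ := by
  ext ω
  simp

theorem measurableSet_forall_notMem {ι α : Type*} [Countable ι] [MeasurableSpace α] {s : Set α}
    (hs : MeasurableSet s) : MeasurableSet {ω : ι → α | ∀ k, ω k ∉ s} := by
  rw [setOf_forall_notMem_eq_pi]
  exact MeasurableSet.univ_pi fun _ => hs.compl

theorem measureReal_pi_forall_notMem {ι α : Type*} [Fintype ι] [MeasurableSpace α] {μ : Measure α}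
    [IsProbabilityMeasure μ] {s : Set α} (hs : MeasurableSet s) :
    (Measure.pi fun _ : ι => μ).real {ω | ∀ k, ω k ∉ s} = (1 - μ.real s) ^ Fintype.card ι := by
  rw [setOf_forall_notMem_eq_pi, Measure.real, Measure.pi_pi, ENNReal.toReal_prod,
    Finset.prod_const, Finset.card_univ, ← probReal_compl_eq_one_sub hs]
  rfl

/-- The event that one of `M` equally spaced caps contains no point of the configuration. -/
def someCapEmpty (ι : Type*) (M : ℕ) : Set (ι → EuclideanSpace ℝ (Fin 2)) :=
  ⋃ m : Fin M, {ω | ∀ k, ω k ∉ openCap (equalDirection M m) (cos (π / M))}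

theorem one_sub_le_measureReal_someCapEmpty {ι : Type*} [Fintype ι] {M : ℕ} (hM : 2 ≤ M) :
    1 - 1 / (M * (1 - 1 / (M : ℝ)) ^ Fintype.card ι) ≤
      (Measure.pi fun _ : ι => sphereUniform2).real (someCapEmpty ι M) := by
  have : NeZero M := ⟨by omega⟩
  have hM' : (2 : ℝ) ≤ M := by exact_mod_cast hM
  have hMinv : 1 / (M : ℝ) < 1 := (div_lt_one (by linarith)).2 (by linarith)
  set p := sphereUniform2.real (openCap (equalDirection M 0) (cos (π / M))) with hp
  have hpM : p ≤ 1 / M := measureReal_openCap_equalDirection_le 0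
  have hpm : ∀ m, sphereUniform2.real (openCap (equalDirection M m) (cos (π / M))) = p :=
    fun m => measureReal_openCap_equalDirection_eq m 0 _
  have hcap : ∀ m : Fin M, MeasurableSet (openCap (equalDirection M m) (cos (π / M))) :=
    fun m => measurableSet_openCap _ _
  have hq : 0 < (1 - p) ^ Fintype.card ι := pow_pos (by linarith) _
  have hbound := one_sub_le_measureReal_iUnion (P := Measure.pi fun _ : ι => sphereUniform2)
    (E := fun m : Fin M => {ω | ∀ k, ω k ∉ openCap (equalDirection M m) (cos (π / M))})
    (fun m => measurableSet_forall_notMem (hcap m)) hq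
    (fun m => by rw [measureReal_pi_forall_notMem (hcap m), hpm]) ?_
  · refine le_trans ?_ hbound
    rw [Fintype.card_fin]
    have hpow : (1 - 1 / (M : ℝ)) ^ Fintype.card ι ≤ (1 - p) ^ Fintype.card ι :=
      pow_le_pow_left₀ (by linarith) (by linarith) _
    have hpos : 0 < (1 - 1 / (M : ℝ)) ^ Fintype.card ι := pow_pos (by linarith) _
    gcongr
  · intro m n hmn
    have hinter : {ω : ι → EuclideanSpace ℝ (Fin 2) |
          ∀ k, ω k ∉ openCap (equalDirection M m) (cos (π / M))} ∩
        {ω | ∀ k, ω k ∉ openCap (equalDirection M n) (cos (π / M))} =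
        {ω | ∀ k, ω k ∉ openCap (equalDirection M m) (cos (π / M)) ∪
          openCap (equalDirection M n) (cos (π / M))} := by
      ext ω
      simp [forall_and]
    have hunion : sphereUniform2.real (openCap (equalDirection M m) (cos (π / M)) ∪
        openCap (equalDirection M n) (cos (π / M))) = 2 * p := by
      rw [Measure.real, measure_union₀ (hcap n).nullMeasurableSet
        (aedisjoint_openCap_equalDirection hmn),
        ENNReal.toReal_add (measure_ne_top _ _) (measure_ne_top _ _)]
      have h1 := hpm m
      have h2 := hpm n
      rw [Measure.real] at h1 h2
      rw [h1, h2]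
      ring
    have h1 : 2 * p ≤ 1 := hunion ▸ measureReal_le_one
    rw [hinter, measureReal_pi_forall_notMem ((hcap m).union (hcap n)), hunion, ← pow_mul,
      mul_comm (Fintype.card ι) 2, pow_mul]
    exact pow_le_pow_left₀ (by linarith) (by nlinarith [sq_nonneg p]) _

theorem one_lt_dist_of_mem_openCap {u x y : EuclideanSpace ℝ (Fin 2)} (hu : ‖u‖ = 1)
    (hx : x ∈ openCap u (1 / 2)) (hy : y ∈ openCap (-u) (1 / 2)) : 1 < dist x y := by
  simp only [openCap, Set.mem_ofPred_eq, inner_neg_left] at hx hy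
  have h := real_inner_le_norm u (x - y)
  rw [inner_sub_right, hu, one_mul, ← dist_eq_norm] at h
  linarith

theorem ae_forall_mem_sphere (ι : Type*) [Fintype ι] :
    ∀ᵐ ω ∂(Measure.pi fun _ : ι => sphereUniform2),
      ∀ k, ω k ∈ sphere (0 : EuclideanSpace ℝ (Fin 2)) 1 :=
  ae_all_iff.2 fun _ => Measure.tendsto_eval_ae_ae.eventually ae_sphereUniform2_mem_sphere

theorem integrable_maxEdgeLength (ι : Type*) [Fintype ι] :
    Integrable (fun ω : ι → EuclideanSpace ℝ (Fin 2) =>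
      maxEdgeLength (convexHull ℝ (Set.range ω))) (Measure.pi fun _ => sphereUniform2) := by
  refine Integrable.of_bound (measurable_maxEdgeLength_convexHull_range ι).aestronglyMeasurable 2 ?_
  filter_upwards [ae_forall_mem_sphere ι] with ω hω
  rw [Real.norm_of_nonneg (maxEdgeLength_nonneg _), maxEdgeLength_convexHull_range]
  refine Real.iSup_le (fun p => ?_) zero_le_two
  unfold supportingDist
  split_ifs
  · have h := dist_triangle_right (ω p.1) (ω p.2) 0
    rw [mem_sphere.1 (hω p.1), mem_sphere.1 (hω p.2)] at h
    linarith
  · exact zero_le_two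

/-- Lower bound for the expected maximal edge length in terms of the number `M` of caps. -/
theorem le_integral_maxEdgeLength {ι : Type*} [Fintype ι] {M : ℕ} (hM : 7 ≤ M) :
    2 * sin (π / M) * (1 - 1 / (M * (1 - 1 / (M : ℝ)) ^ Fintype.card ι) -
        2 * (3 / 4) ^ Fintype.card ι) ≤
      ∫ ω, maxEdgeLength (convexHull ℝ (Set.range ω))
        ∂(Measure.pi fun _ : ι => sphereUniform2) := by
  set P := Measure.pi fun _ : ι => sphereUniform2 with hP
  have hM' : (7 : ℝ) ≤ M := by exact_mod_cast hM
  have hα : 0 ≤ π / M := by positivity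
  have hα' : π / M ≤ 1 / 2 := by
    rw [div_le_iff₀ (by linarith)]
    linarith [pi_lt_d2]
  have hsin : 0 ≤ sin (π / M) := sin_nonneg_of_nonneg_of_le_pi hα (by linarith [pi_gt_three])
  refine le_trans ?_ (mul_meas_ge_le_integral_of_nonneg
    (Filter.Eventually.of_forall fun ω => maxEdgeLength_nonneg _) (integrable_maxEdgeLength ι)
    (2 * sin (π / M)))
  refine mul_le_mul_of_nonneg_left ?_ (by positivity)
  set u := circlePoint 0 with hu
  have hunorm : ‖u‖ = 1 := norm_circlePoint 0
  have hempty : ∀ v : EuclideanSpace ℝ (Fin 2), ‖v‖ = 1 →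
      P.real {ω | ∀ k, ω k ∉ openCap v (1 / 2)} ≤ (3 / 4) ^ Fintype.card ι := by
    intro v hv
    rw [hP, measureReal_pi_forall_notMem (measurableSet_openCap _ _)]
    have h1 := one_fourth_le_measureReal_openCap hv
    have h2 : sphereUniform2.real (openCap v (1 / 2)) ≤ 1 := measureReal_le_one
    exact pow_le_pow_left₀ (by linarith) (by linarith) _
  have hsub : someCapEmpty ι M ≤ᵐ[P]
      ({ω | 2 * sin (π / M) ≤ maxEdgeLength (convexHull ℝ (Set.range ω))} ∪
        {ω | ∀ k, ω k ∉ openCap u (1 / 2)} ∪ {ω | ∀ k, ω k ∉ openCap (-u) (1 / 2)} :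
        Set (ι → EuclideanSpace ℝ (Fin 2))) := by
    filter_upwards [ae_forall_mem_sphere ι] with ω hω hmem
    refine Classical.byContradiction fun (hcon : ω ∉ (_ ∪ _ : Set _)) => ?_
    obtain ⟨m, hm⟩ := Set.mem_iUnion.1 hmem
    simp only [Set.mem_union, Set.mem_ofPred_eq, not_or, not_forall, not_not, not_le] at hcon
    obtain ⟨⟨hlt, a, ha⟩, b, hb⟩ := hcon
    obtain ⟨p, hp, hle⟩ := exists_isSupportingPair_of_openCap hω hα hα' hm
      (one_lt_dist_of_mem_openCap hunorm ha hb).le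
    rw [maxEdgeLength_convexHull_range] at hlt
    refine hlt.not_ge (hle.trans ?_)
    refine le_trans ?_ (le_ciSup (Set.finite_range _).bddAbove p)
    rw [supportingDist, if_pos hp]
  have h1 := one_sub_le_measureReal_someCapEmpty (ι := ι) (by omega : 2 ≤ M)
  have h2 : P.real (someCapEmpty ι M) ≤ P.real _ :=
    ENNReal.toReal_mono (measure_ne_top _ _) (measure_mono_ae hsub)
  have h3 := measureReal_union_le (μ := P)
    ({ω | 2 * sin (π / M) ≤ maxEdgeLength (convexHull ℝ (Set.range ω))} ∪
        {ω | ∀ k, ω k ∉ openCap u (1 / 2)}) {ω | ∀ k, ω k ∉ openCap (-u) (1 / 2)}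
  have h4 := measureReal_union_le (μ := P)
    {ω | 2 * sin (π / M) ≤ maxEdgeLength (convexHull ℝ (Set.range ω))}
    {ω | ∀ k, ω k ∉ openCap u (1 / 2)}
  have h5 := hempty u hunorm
  have h6 := hempty (-u) (by rw [norm_neg, hunorm])
  linarith

theorem expected_max_edge_lower :
    ∃ N₀ : ℕ, ∀ N : ℕ, N₀ ≤ N →
      (1 / (2 * π)) * (Real.log N / N) ≤
        ∫ ω, maxEdgeLength (convexHull ℝ (Set.range ω))
          ∂(Measure.pi fun _ : Fin N => sphereUniform2) := by
  have hlog : ∀ᶠ N : ℕ in Filter.atTop, Real.log N ≤ (1 / 8) * (N : ℝ) ^ (1 / 2 : ℝ) := by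
    have h := ((isLittleO_log_rpow_atTop (r := 1 / 2) (by norm_num)).bound
      (by norm_num : (0 : ℝ) < 1 / 8))
    filter_upwards [tendsto_natCast_atTop_atTop.eventually h] with N hN
    rw [Real.norm_of_nonneg (by positivity : (0 : ℝ) ≤ (N : ℝ) ^ (1 / 2 : ℝ))] at hN
    exact (le_abs_self _).trans hN
  have hpow : ∀ᶠ N : ℕ in Filter.atTop, (3 / 4 : ℝ) ^ N ≤ 1 / 8 :=
    ((tendsto_pow_atTop_nhds_zero_of_lt_one (by norm_num) (by norm_num)).eventually
      (ge_mem_nhds (by norm_num : (0 : ℝ) < 1 / 8)))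
  obtain ⟨N₀, hN₀⟩ := Filter.eventually_atTop.1
    ((hlog.and hpow).and (Filter.eventually_ge_atTop 3))
  refine ⟨N₀, fun N hN => ?_⟩
  obtain ⟨⟨hl, h34⟩, hN3⟩ := hN₀ N hN
  have hN3' : (3 : ℝ) ≤ N := by exact_mod_cast hN3
  set s : ℝ := (N : ℝ) ^ (1 / 2 : ℝ) with hs
  set L : ℝ := Real.log N with hL
  have hs1 : 1 ≤ s := one_le_rpow (by linarith) (by norm_num)
  have hss : s * s = N := by
    rw [hs, ← rpow_add (by linarith)]
    norm_num
  have hexpL : exp (L / 2) = s := by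
    rw [hs, rpow_def_of_pos (by linarith), hL]
    congr 1
    ring
  have hL0 : 0 < L := log_pos (by linarith)
  set x : ℝ := 2 * N / L with hx
  have hx16 : 16 * s ≤ x := by
    rw [hx, le_div_iff₀ hL0]
    nlinarith
  set M : ℕ := ⌈x⌉₊ + 1 with hMdef
  have hMx : x + 1 ≤ M := by
    rw [hMdef]
    push_cast
    linarith [Nat.le_ceil x]
  have hMx' : (M : ℝ) < x + 2 := by
    rw [hMdef]
    push_cast
    linarith [Nat.ceil_lt_add_one (by linarith : 0 ≤ x)]
  have hM7 : 7 ≤ M := by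
    have : (7 : ℝ) ≤ M := by linarith
    exact_mod_cast this
  have hM0 : (0 : ℝ) < M := by linarith
  have hq : s⁻¹ ≤ (1 - 1 / (M : ℝ)) ^ N := by
    have h1 : (1 - 1 / (M : ℝ))⁻¹ ≤ exp (1 / x) := by
      have h2 : (1 - 1 / (M : ℝ))⁻¹ = 1 / (M - 1) + 1 := by
        have : (M : ℝ) - 1 ≠ 0 := by linarith
        field_simp
        ring
      rw [h2]
      refine le_trans ?_ (add_one_le_exp _)
      gcongr
      linarith
    have h3 : 0 < 1 - 1 / (M : ℝ) := by
      have : 1 / (M : ℝ) < 1 := (div_lt_one hM0).2 (by linarith)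
      linarith
    have h4 : ((1 - 1 / (M : ℝ)) ^ N)⁻¹ ≤ s := by
      rw [← inv_pow]
      refine (pow_le_pow_left₀ (inv_nonneg.2 h3.le) h1 N).trans (le_of_eq ?_)
      rw [← exp_nat_mul, ← hexpL, hx]
      congr 1
      field_simp
    exact inv_le_of_inv_le₀ (pow_pos h3 _) h4
  have hprob : 1 / 4 ≤ 1 - 1 / (M * (1 - 1 / (M : ℝ)) ^ N) - 2 * (3 / 4) ^ N := by
    have h1 : 2 ≤ M * (1 - 1 / (M : ℝ)) ^ N := by
      calc (2 : ℝ) ≤ 16 * s * s⁻¹ := by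
            rw [mul_assoc, mul_inv_cancel₀ (by linarith)]
            norm_num
        _ ≤ M * (1 - 1 / (M : ℝ)) ^ N :=
            mul_le_mul (by linarith) hq (by positivity) hM0.le
    have h2 : 1 / (M * (1 - 1 / (M : ℝ)) ^ N) ≤ 1 / 2 := by gcongr
    linarith
  have hsin : 4 / (M : ℝ) ≤ 2 * sin (π / M) := by
    have h := mul_le_sin (x := π / M) (by positivity) (by gcongr; linarith)
    have h2 : 2 / π * (π / M) = 2 / (M : ℝ) := by
      field_simp
    rw [h2] at h
    have h3 : 4 / (M : ℝ) = 2 * (2 / M) := by ring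
    linarith
  have hmain := le_integral_maxEdgeLength (ι := Fin N) hM7
  rw [Fintype.card_fin] at hmain
  refine le_trans ?_ hmain
  have hML : (M : ℝ) ≤ 3 * N / L := by
    have : 3 * N / L = x + x / 2 := by
      rw [hx]
      ring
    linarith
  calc 1 / (2 * π) * (L / N) ≤ 1 / 3 * (L / N) := by
        gcongr
        linarith [pi_gt_three]
    _ = 1 / (3 * N / L) := by field_simp
    _ ≤ 1 / M := by gcongr
    _ = 4 / M * (1 / 4) := by ring
    _ ≤ _ := mul_le_mul hsin hprob (by norm_num) (le_trans (by positivity) hsin)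
end
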